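/- The function h(z) = Re ∫_{ζ₋}^z R(t)/(t²−1) dt, where the path of integration lies in ℂ∖Γ_C, is single-valued and harmonic on ℂ∖(Γ_C ∪ {−1, 1}); it satisfies h(z) > 0 for all z in the unbounded component Ω_∞ of ℂ∖Γ, and h(z) < 0 for all z in each of the two bounded components Ω_{−1} and Ω_{1} of ℂ∖Γ (minus the points −1 and 1). -/

import Mathlib

open Complex Set Filter Topology Bornology

noncomputable section

/-- The branch point `ζ₊`. -/
def zetaP (A B : ℝ) : ℂ :=
  (((B : ℂ) ^ 2 - (A : ℂ) ^ 2) +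
      4 * Complex.I * ((Real.sqrt ((A + 1) * (B + 1) * (-A - B - 1)) : ℝ) : ℂ)) /
    ((A : ℂ) + (B : ℂ) + 2) ^ 2

/-- The branch point `ζ₋`. -/
def zetaM (A B : ℝ) : ℂ :=
  (((B : ℂ) ^ 2 - (A : ℂ) ^ 2) -
      4 * Complex.I * ((Real.sqrt ((A + 1) * (B + 1) * (-A - B - 1)) : ℝ) : ℂ)) /
    ((A : ℂ) + (B : ℂ) + 2) ^ 2

/-- The set `Γ = { z : Re ∫_{ζ₋}^z ((t−ζ₊)(t−ζ₋))^{1/2}/(t²−1) dt = 0 }`. -/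
def GammaSet (A B : ℝ) : Set ℂ :=
  {z | ∃ γ g : ℝ → ℂ, ContDiff ℝ 1 γ ∧ γ 0 = zetaM A B ∧ γ 1 = z ∧
    (∀ t ∈ Set.Icc (0 : ℝ) 1, γ t ≠ 1 ∧ γ t ≠ -1) ∧
    ContinuousOn g (Set.Icc 0 1) ∧
    (∀ t ∈ Set.Icc (0 : ℝ) 1, g t ^ 2 = (γ t - zetaP A B) * (γ t - zetaM A B)) ∧
    (∫ t in (0:ℝ)..1, g t / ((γ t) ^ 2 - 1) * deriv γ t).re = 0}

/-- `ΓC` is the central arc of `Γ`: compact, connected, joining `ζ₋` and `ζ₊`,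
contained in `Γ`, and meeting the real axis only inside `(−1,1)`. -/
def IsCenterArc (A B : ℝ) (ΓC : Set ℂ) : Prop :=
  IsCompact ΓC ∧ IsConnected ΓC ∧ zetaP A B ∈ ΓC ∧ zetaM A B ∈ ΓC ∧
  ΓC ⊆ GammaSet A B ∧ ∀ z ∈ ΓC, z.im = 0 → -1 < z.re ∧ z.re < 1

/-- `R` is the single-valued analytic branch of `((z−ζ₊)(z−ζ₋))^{1/2}` on `ℂ ∖ Γ_C`
with `R(z)/z → 1` as `z → ∞`. -/
def IsSqrtBranch (A B : ℝ) (ΓC : Set ℂ) (R : ℂ → ℂ) : Prop :=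
  DifferentiableOn ℂ R ΓCᶜ ∧
  (∀ z ∉ ΓC, R z ^ 2 = (z - zetaP A B) * (z - zetaM A B)) ∧
  Tendsto (fun z => R z / z) (Bornology.cobounded ℂ) (nhds 1)

/-- An admissible path of integration from `ζ₋` to `z` avoiding `Γ_C` and `±1`
(except for the initial point `ζ₋ ∈ Γ_C`). -/
def AdmissiblePath (A B : ℝ) (ΓC : Set ℂ) (z : ℂ) (γ : ℝ → ℂ) : Prop :=
  ContDiff ℝ 1 γ ∧ γ 0 = zetaM A B ∧ γ 1 = z ∧
    ∀ t ∈ Set.Ioc (0 : ℝ) 1, γ t ∉ ΓC ∧ γ t ≠ 1 ∧ γ t ≠ -1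

/-! ### Topological lemmas -/

lemma aux_punctured_ball (p : ℂ) (r : ℝ) (hr : 0 < r) :
    IsPreconnected (Metric.ball p r \ {p}) := by
  have h1 : Metric.ball p r \ {p} = (fun w : ℂ => p + Complex.exp w) '' {w : ℂ | w.re < Real.log r} := by
    ext z
    simp only [Set.mem_sdiff, Metric.mem_ball, mem_singleton_iff, mem_image, mem_ofPred_eq]
    constructor
    · rintro ⟨hz, hne⟩
      have hne' : z - p ≠ 0 := sub_ne_zero.mpr hne
      refine ⟨Complex.log (z - p), ?_, ?_⟩
      · rw [Complex.log_re]
        rw [dist_eq_norm] at hz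
        exact Real.log_lt_log (norm_pos_iff.mpr hne') hz
      · rw [Complex.exp_log hne']; ring
    · rintro ⟨w, hw, rfl⟩
      refine ⟨?_, ?_⟩
      · rw [dist_eq_norm]
        simp only [add_sub_cancel_left, Complex.norm_exp]
        exact (Real.lt_log_iff_exp_lt hr).mp hw
      · simp [Complex.exp_ne_zero]
  rw [h1]
  apply IsPreconnected.image
  · exact (convex_halfSpace_re_lt _).isPreconnected
  · fun_prop

lemma aux_exterior (r : ℝ) (hr : 0 < r) :
    IsPreconnected {z : ℂ | r < ‖z‖} := by
  have h1 : {z : ℂ | r < ‖z‖} = (fun w : ℂ => Complex.exp w) '' {w : ℂ | Real.log r < w.re} := by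
    ext z
    simp only [mem_image, mem_ofPred_eq]
    constructor
    · intro hz
      have hne' : z ≠ 0 := by
        rintro rfl
        simp at hz; linarith
      refine ⟨Complex.log z, ?_, ?_⟩
      · rw [Complex.log_re]
        exact Real.log_lt_log hr hz
      · rw [Complex.exp_log hne']
    · rintro ⟨w, hw, rfl⟩
      rw [Complex.norm_exp]
      exact (Real.log_lt_iff_lt_exp hr).mp hw
  rw [h1]
  apply IsPreconnected.image
  · exact (convex_halfSpace_re_gt _).isPreconnected
  · fun_prop

lemma aux_diff_point (U : Set ℂ) (hU : IsOpen U) (hc : IsPreconnected U) (p : ℂ) :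
    IsPreconnected (U \ {p}) := by
  by_cases hp : p ∈ U
  swap
  · rwa [sdiff_singleton_eq_self hp]
  obtain ⟨r, hr, hball⟩ := Metric.isOpen_iff.mp hU p hp
  have hP := aux_punctured_ball p r hr
  have hPs : Metric.ball p r \ {p} ⊆ U \ {p} := sdiff_subset_sdiff_left hball
  have hUo : IsOpen (U \ {p}) := hU.sdiff isClosed_singleton
  have key : ∀ u v : Set ℂ, IsOpen u → IsOpen v → U \ {p} ⊆ u ∪ v → (U \ {p}) ∩ (u ∩ v) = ∅ →
      Metric.ball p r \ {p} ⊆ u → U \ {p} ⊆ u := by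
    intro u v hu hv huv hd hPu
    have h2 := isPreconnected_iff_subset_of_disjoint.mp hc
      ((u ∩ (U \ {p})) ∪ Metric.ball p r) (v ∩ (U \ {p}))
      ((hu.inter hUo).union Metric.isOpen_ball) (hv.inter hUo) ?_ ?_
    · rcases h2 with h2 | h2
      · intro z hz
        rcases h2 hz.1 with h3 | h3
        · exact h3.1
        · exact hPu ⟨h3, hz.2⟩
      · exact absurd rfl (h2 hp).2.2
    · intro z hz
      by_cases hzp : z = p
      · left; right; rw [hzp]; exact Metric.mem_ball_self hr
      · rcases huv ⟨hz, hzp⟩ with h3 | h3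
        · left; left; exact ⟨h3, hz, hzp⟩
        · right; exact ⟨h3, hz, hzp⟩
    · rw [eq_empty_iff_forall_notMem] at hd ⊢
      rintro z ⟨hz, h3 | h3, h4⟩
      · exact hd z ⟨h4.2, h3.1, h4.1⟩
      · exact hd z ⟨h4.2, hPu ⟨h3, h4.2.2⟩, h4.1⟩
  rw [isPreconnected_iff_subset_of_disjoint]
  intro u v hu hv huv hd
  rcases isPreconnected_iff_subset_of_disjoint.mp hP u v hu hv (hPs.trans huv) (by
    rw [eq_empty_iff_forall_notMem] at hd ⊢
    exact fun z hz => hd z ⟨hPs hz.1, hz.2⟩) with h1 | h1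
  · left; exact key u v hu hv huv hd h1
  · right
    exact key v u hv hu (by rwa [union_comm]) (by rwa [inter_comm v u]) h1

/-- In an open preconnected set every point can be reached by a `C¹` path. -/
lemma aux_reach (U : Set ℂ) (hU : IsOpen U) (hc : IsPreconnected U) (x : ℂ)
    (γ₀ : ℝ → ℂ) (h0 : ContDiff ℝ 1 γ₀) (h0x : γ₀ 0 = x) (h0U : ∀ t ∈ Ioc (0:ℝ) 1, γ₀ t ∈ U)
    (z : ℂ) (hz : z ∈ U) :
    ∃ γ : ℝ → ℂ, ContDiff ℝ 1 γ ∧ γ 0 = x ∧ γ 1 = z ∧ ∀ t ∈ Ioc (0:ℝ) 1, γ t ∈ U := by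
  set S : Set ℂ := {z | ∃ γ : ℝ → ℂ, ContDiff ℝ 1 γ ∧ γ 0 = x ∧ γ 1 = z ∧
    ∀ t ∈ Ioc (0:ℝ) 1, γ t ∈ U} with hS
  have step : ∀ z r, 0 < r → Metric.ball z r ⊆ U → z ∈ S → ∀ w, dist w z < r / 2 → w ∈ S := by
    rintro z r hr hb ⟨γ, hγ, hγ0, hγ1, hγU⟩ w hw
    have hcont : ContinuousAt γ 1 := hγ.continuous.continuousAt
    obtain ⟨δ, hδ, hδ'⟩ := Metric.continuousAt_iff.mp hcont (r/2) (by linarith)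
    set η := min (δ/2) (1/2) with hη
    have hηpos : 0 < η := by positivity
    have hη1 : η ≤ 1/2 := min_le_right _ _
    have hη2 : η ≤ δ/2 := min_le_left _ _
    set ψ : ℝ → ℝ := fun t => Real.smoothTransition ((t - (1 - η)) / η) with hψ
    have hψs : ContDiff ℝ 1 ψ := by
      apply Real.smoothTransition.contDiff.comp
      fun_prop
    refine ⟨fun t => γ t + (ψ t : ℂ) * (w - z), ?_, ?_, ?_, ?_⟩
    · have : ContDiff ℝ 1 (fun t => (ψ t : ℂ)) := Complex.ofRealCLM.contDiff.comp hψs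
      fun_prop
    · have : ψ 0 = 0 := Real.smoothTransition.zero_of_nonpos (by
        apply div_nonpos_of_nonpos_of_nonneg <;> linarith)
      simp [this, hγ0]
    · have : ψ 1 = 1 := Real.smoothTransition.one_of_one_le (by
        rw [le_div_iff₀ hηpos]; linarith)
      simp [this, hγ1]
    · intro t ht
      by_cases htη : t ≤ 1 - η
      · have : ψ t = 0 := Real.smoothTransition.zero_of_nonpos (by
          apply div_nonpos_of_nonpos_of_nonneg <;> linarith)
        simpa [this] using hγU t ht
      · push Not at htη
        apply hb
        have h1 : dist (γ t) (γ 1) < r / 2 := by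
          apply hδ'
          rw [Real.dist_eq, abs_lt]
          constructor <;> linarith [ht.2]
        rw [hγ1, dist_eq_norm] at h1
        rw [dist_eq_norm] at hw
        rw [Metric.mem_ball, dist_eq_norm]
        have h2 : ‖(ψ t : ℂ) * (w - z)‖ ≤ ‖w - z‖ := by
          rw [norm_mul]
          have h3 : ‖(ψ t : ℂ)‖ ≤ 1 := by
            rw [Complex.norm_real, Real.norm_eq_abs, abs_of_nonneg (Real.smoothTransition.nonneg _)]
            exact Real.smoothTransition.le_one _
          nlinarith [norm_nonneg (w - z)]
        calc ‖γ t + (ψ t : ℂ) * (w - z) - z‖ = ‖(γ t - z) + (ψ t : ℂ) * (w - z)‖ := by ring_nf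
          _ ≤ ‖γ t - z‖ + ‖(ψ t : ℂ) * (w - z)‖ := norm_add_le _ _
          _ < r := by linarith
  have hSU : S ⊆ U := by
    rintro z ⟨γ, -, -, h1, h2⟩
    rw [← h1]; exact h2 1 ⟨by norm_num, le_rfl⟩
  have hSo : IsOpen S := by
    rw [Metric.isOpen_iff]
    intro z hz
    obtain ⟨r, hr, hb⟩ := Metric.isOpen_iff.mp hU z (hSU hz)
    exact ⟨r/2, by linarith, fun w hw => step z r hr hb hz w hw⟩
  have hTo : IsOpen (U \ S) := by
    rw [Metric.isOpen_iff]
    rintro z ⟨hz, hzS⟩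
    obtain ⟨r, hr, hb⟩ := Metric.isOpen_iff.mp hU z hz
    refine ⟨r/4, by linarith, fun w hw => ⟨hb (Metric.ball_subset_ball (by linarith) hw), fun hwS => hzS ?_⟩⟩
    rw [Metric.mem_ball] at hw
    refine step w (3*r/4) (by linarith) (fun y hy => hb ?_) hwS z (by rw [dist_comm]; linarith)
    rw [Metric.mem_ball] at hy ⊢
    linarith [dist_triangle y w z]
  have hne : γ₀ 1 ∈ S := ⟨γ₀, h0, h0x, rfl, h0U⟩
  rcases isPreconnected_iff_subset_of_disjoint.mp hc S (U \ S) hSo hTo (by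
    intro y hy; by_cases h : y ∈ S
    · exact Or.inl h
    · exact Or.inr ⟨hy, h⟩) (by
    rw [eq_empty_iff_forall_notMem]
    rintro y ⟨-, h1, h2⟩
    exact h2.2 h1) with h1 | h1
  · exact h1 hz
  · exact absurd hne (h1 (hSU hne)).2

/-! ### The uniformisation -/

structure Par (c d a b : ℝ) : Prop where
  d0 : 0 < d
  a0 : 0 < a
  b0 : b < 0
  ab : a * b < -1
  ea : d * (a ^ 2 - 1) = 2 * (1 - c) * a
  eb : d * (b ^ 2 - 1) = 2 * (-1 - c) * b

def pf (a b : ℝ) : ℝ := (a ^ 2 + 1) * b / ((a - b) * (a * b + 1))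
def qf (a b : ℝ) : ℝ := (b ^ 2 + 1) * a / ((b - a) * (a * b + 1))
def zf (c d : ℝ) (w : ℂ) : ℂ := c + d / 2 * (w - w⁻¹)
def gf (d : ℝ) (w : ℂ) : ℂ := d / 2 * (w + w⁻¹)
def Hf (a b : ℝ) (w : ℂ) : ℝ :=
  Real.log ‖w‖ + (pf a b * (Real.log ‖w - a‖ - Real.log ‖a * w + 1‖) +
    qf a b * (Real.log ‖w - b‖ - Real.log ‖b * w + 1‖))
def Kf (a b : ℝ) (w : ℂ) : ℂ :=
  (w ^ 2 + 1) ^ 2 * (a * b) / (w * ((w - a) * (a * w + 1)) * ((w - b) * (b * w + 1)))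
def Np (a b : ℝ) (w : ℂ) : Prop :=
  w ≠ 0 ∧ w - a ≠ 0 ∧ a * w + 1 ≠ 0 ∧ w - b ≠ 0 ∧ b * w + 1 ≠ 0

lemma Par.p0 {c d a b : ℝ} (P : Par c d a b) : 0 < pf a b := by
  obtain ⟨d0, a0, b0, ab, ea, eb⟩ := P
  apply div_pos_of_neg_of_neg
  · apply mul_neg_of_pos_of_neg _ b0; positivity
  · apply mul_neg_of_pos_of_neg <;> linarith

lemma Par.q0 {c d a b : ℝ} (P : Par c d a b) : 0 < qf a b := by
  obtain ⟨d0, a0, b0, ab, ea, eb⟩ := P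
  apply div_pos
  · positivity
  · apply mul_pos_of_neg_of_neg <;> linarith

lemma zf_sub_one {c d a b : ℝ} (P : Par c d a b) (w : ℂ) (hw : w ≠ 0) :
    zf c d w - 1 = d / 2 * ((w - a) * (a * w + 1)) / (a * w) := by
  have ha : (a : ℂ) ≠ 0 := by exact_mod_cast P.a0.ne'
  have e : (d : ℂ) * (a ^ 2 - 1) = 2 * (1 - c) * a := by exact_mod_cast P.ea
  unfold zf
  field_simp
  linear_combination (w) * e

lemma zf_add_one {c d a b : ℝ} (P : Par c d a b) (w : ℂ) (hw : w ≠ 0) :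
    zf c d w + 1 = d / 2 * ((w - b) * (b * w + 1)) / (b * w) := by
  have ha : (b : ℂ) ≠ 0 := by exact_mod_cast P.b0.ne
  have e : (d : ℂ) * (b ^ 2 - 1) = 2 * (-1 - c) * b := by exact_mod_cast P.eb
  unfold zf
  field_simp
  linear_combination (w) * e

lemma Np_iff {c d a b : ℝ} (P : Par c d a b) (w : ℂ) (hw : w ≠ 0) :
    Np a b w ↔ (zf c d w ≠ 1 ∧ zf c d w ≠ -1) := by
  have ha : (a : ℂ) ≠ 0 := by exact_mod_cast P.a0.ne'
  have hb : (b : ℂ) ≠ 0 := by exact_mod_cast P.b0.ne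
  have hd : (d : ℂ) ≠ 0 := by exact_mod_cast P.d0.ne'
  have h1 : zf c d w ≠ 1 ↔ zf c d w - 1 ≠ 0 := sub_ne_zero.symm
  have h2 : zf c d w ≠ -1 ↔ zf c d w + 1 ≠ 0 := by
    rw [← sub_neg_eq_add]; exact sub_ne_zero.symm
  rw [h1, h2, zf_sub_one P w hw, zf_add_one P w hw]
  unfold Np
  simp [ha, hb, hd, hw]
  tauto

lemma gf_sq (c d : ℝ) (w : ℂ) (hw : w ≠ 0) :
    gf d w ^ 2 = (zf c d w - c) ^ 2 + d ^ 2 := by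
  unfold gf zf
  field_simp
  ring

/-- recover `w` from `z` and a root `g`. -/
lemma w_spec (c d : ℝ) (hd : d ≠ 0) (z g : ℂ) (h : g ^ 2 = (z - c) ^ 2 + d ^ 2) :
    (z - c + g) / d ≠ 0 ∧ zf c d ((z - c + g) / d) = z ∧ gf d ((z - c + g) / d) = g := by
  have hd' : (d : ℂ) ≠ 0 := by exact_mod_cast hd
  have h1 : (z - c + g) * (g - (z - c)) = d ^ 2 := by linear_combination h
  have h0 : z - c + g ≠ 0 := by
    intro h0; rw [h0, zero_mul] at h1
    exact pow_ne_zero 2 hd' h1.symm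
  refine ⟨div_ne_zero h0 hd', ?_, ?_⟩
  · unfold zf; field_simp; linear_combination h1
  · unfold gf; field_simp; linear_combination -h1

lemma w_of_zg (c d : ℝ) (hd : d ≠ 0) (w : ℂ) : (zf c d w - c + gf d w) / d = w := by
  have hd' : (d : ℂ) ≠ 0 := by exact_mod_cast hd
  have : zf c d w - c + gf d w = d * w := by unfold zf gf; ring
  rw [this]; field_simp

lemma zf_inj (c d : ℝ) (hd : d ≠ 0) (w v : ℂ) (hw : w ≠ 0) (hv : v ≠ 0) (h : zf c d w = zf c d v) :
    w = v ∨ w = - v⁻¹ := by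
  have hd' : (d : ℂ) ≠ 0 := by exact_mod_cast hd
  have h1 : (w - v) * (w * v + 1) = 0 := by
    unfold zf at h
    field_simp at h
    apply mul_left_cancel₀ hd'
    linear_combination h
  rcases mul_eq_zero.mp h1 with h2 | h2
  · left; linear_combination h2
  · right; field_simp; linear_combination h2

lemma Hf_anti (a b : ℝ) (w : ℂ) (h : Np a b w) : Hf a b (-w⁻¹) = - Hf a b w := by
  obtain ⟨h0, h1, h2, h3, h4⟩ := h
  have e1 : ‖-w⁻¹ - a‖ = ‖a * w + 1‖ / ‖w‖ := by
    rw [← norm_div, ← norm_neg]; congr 1; field_simp; ring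
  have e2 : ‖a * -w⁻¹ + 1‖ = ‖w - a‖ / ‖w‖ := by
    rw [← norm_div]; congr 1; field_simp; ring
  have e3 : ‖-w⁻¹ - b‖ = ‖b * w + 1‖ / ‖w‖ := by
    rw [← norm_div, ← norm_neg]; congr 1; field_simp; ring
  have e4 : ‖b * -w⁻¹ + 1‖ = ‖w - b‖ / ‖w‖ := by
    rw [← norm_div]; congr 1; field_simp; ring
  have hn := norm_ne_zero_iff.mpr h0
  unfold Hf
  rw [e1, e2, e3, e4, Real.log_div (norm_ne_zero_iff.mpr h2) hn,
    Real.log_div (norm_ne_zero_iff.mpr h1) hn, Real.log_div (norm_ne_zero_iff.mpr h4) hn,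
    Real.log_div (norm_ne_zero_iff.mpr h3) hn, norm_neg, norm_inv, Real.log_inv]
  ring

lemma Hf_negI (a b : ℝ) : Hf a b (-I) = 0 := by
  have e (x : ℝ) : ‖-I - (x:ℂ)‖ = ‖x * -I + 1‖ := by
    have : (-I - (x:ℂ)) = -I * (-(x * I) + 1) := by
      linear_combination (-x : ℂ) * Complex.I_mul_I
    rw [this, norm_mul]; simp
  unfold Hf
  rw [e a, e b]; simp

lemma log_loc (f f' : ℂ → ℂ) (w : ℂ) (hf : ∀ᶠ v in 𝓝 w, HasDerivAt f (f' v) v)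
    (h0 : f w ≠ 0) :
    ∃ F : ℂ → ℂ, ∀ᶠ v in 𝓝 w, HasDerivAt F (f' v / f v) v ∧ Real.log ‖f v‖ = (F v).re := by
  have hc : ContinuousAt (fun v => f v / f w) w := hf.self_of_nhds.continuousAt.div_const _
  have h1 : ∀ᶠ v in 𝓝 w, f v / f w ∈ slitPlane :=
    hc.eventually_mem (Complex.isOpen_slitPlane.mem_nhds (by simp [h0]))
  refine ⟨fun v => Complex.log (f v / f w) + Real.log ‖f w‖, ?_⟩
  filter_upwards [hf, h1] with v hv h2
  have h3 : f v ≠ 0 := by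
    intro h; rw [h] at h2; simp at h2
  constructor
  · have := ((hv.div_const (f w)).clog h2).add_const ((Real.log ‖f w‖ : ℝ) : ℂ)
    rwa [div_div_div_cancel_right₀ h0] at this
  · simp only [add_re, Complex.log_re, norm_div, ofReal_re]
    rw [Real.log_div (norm_ne_zero_iff.mpr h3) (norm_ne_zero_iff.mpr h0)]
    ring

lemma Kf_eq {c d a b : ℝ} (P : Par c d a b) (w : ℂ) (h : Np a b w) :
    Kf a b w = 1 / w + (pf a b * (1 / (w - a) - a / (a * w + 1)) +
      qf a b * (1 / (w - b) - b / (b * w + 1))) := by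
  obtain ⟨h0, h1, h2, h3, h4⟩ := h
  have e1 : (a : ℂ) - b ≠ 0 := by
    have : a - b ≠ 0 := by linarith [P.a0, P.b0]
    exact_mod_cast this
  have e2 : (a : ℂ) * b + 1 ≠ 0 := by
    have : a * b + 1 ≠ 0 := by linarith [P.ab]
    exact_mod_cast this
  have e3 : (b : ℂ) - a ≠ 0 := by
    rw [← neg_sub]; exact neg_ne_zero.mpr e1
  unfold Kf pf qf
  push_cast
  have : (b : ℂ) - a = -(a - b) := by ring
  rw [this]
  have h2' : w * (a : ℂ) + 1 ≠ 0 := by rwa [mul_comm]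
  have h4' : w * (b : ℂ) + 1 ≠ 0 := by rwa [mul_comm]
  rw [mul_comm (a : ℂ) w, mul_comm (b : ℂ) w]
  generalize hX : w * (a : ℂ) + 1 = X at *
  generalize hY : w * (b : ℂ) + 1 = Y at *
  generalize hZ : (a : ℂ) * b + 1 = Z at *
  generalize hT : (a : ℂ) - b = T at *
  field_simp
  subst hX hY hZ hT
  ring

lemma Hf_loc {c d a b : ℝ} (P : Par c d a b) (w : ℂ) (h : Np a b w) :
    ∃ F : ℂ → ℂ, ∀ᶠ v in 𝓝 w, HasDerivAt F (Kf a b v) v ∧ Hf a b v = (F v).re := by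
  obtain ⟨h0, h1, h2, h3, h4⟩ := id h
  obtain ⟨F0, H0⟩ := log_loc (fun v => v) (fun _ => 1) w (.of_forall fun v => hasDerivAt_id v) h0
  obtain ⟨F1, H1⟩ := log_loc (fun v => v - a) (fun _ => 1) w
    (.of_forall fun v => (hasDerivAt_id v).sub_const _) h1
  obtain ⟨F2, H2⟩ := log_loc (fun v => a * v + 1) (fun _ => a) w
    (.of_forall fun v => by simpa using ((hasDerivAt_id v).const_mul (a:ℂ)).add_const 1) h2
  obtain ⟨F3, H3⟩ := log_loc (fun v => v - b) (fun _ => 1) w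
    (.of_forall fun v => (hasDerivAt_id v).sub_const _) h3
  obtain ⟨F4, H4⟩ := log_loc (fun v => b * v + 1) (fun _ => b) w
    (.of_forall fun v => by simpa using ((hasDerivAt_id v).const_mul (b:ℂ)).add_const 1) h4
  refine ⟨fun v => F0 v + (pf a b * (F1 v - F2 v) + qf a b * (F3 v - F4 v)), ?_⟩
  have hN : ∀ᶠ v in 𝓝 w, Np a b v := by
    have c0 : ContinuousAt (fun v : ℂ => v) w := by fun_prop
    have c1 : ContinuousAt (fun v : ℂ => v - a) w := by fun_prop
    have c2 : ContinuousAt (fun v : ℂ => a * v + 1) w := by fun_prop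
    have c3 : ContinuousAt (fun v : ℂ => v - b) w := by fun_prop
    have c4 : ContinuousAt (fun v : ℂ => b * v + 1) w := by fun_prop
    filter_upwards [c0.eventually_ne h0, c1.eventually_ne h1, c2.eventually_ne h2,
      c3.eventually_ne h3, c4.eventually_ne h4] with v a0 a1 a2 a3 a4
    exact ⟨a0, a1, a2, a3, a4⟩
  filter_upwards [H0, H1, H2, H3, H4, hN] with v a0 a1 a2 a3 a4 hv
  constructor
  · rw [Kf_eq P v hv]
    exact a0.1.add (((a1.1.sub a2.1).const_mul _).add ((a3.1.sub a4.1).const_mul _))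
  · unfold Hf
    rw [a0.2, a1.2, a2.2, a3.2, a4.2]
    simp

lemma Hf_cont {c d a b : ℝ} (P : Par c d a b) (w : ℂ) (h : Np a b w) : ContinuousAt (Hf a b) w := by
  obtain ⟨F, hF⟩ := Hf_loc P w h
  have h1 : ContinuousAt (fun v => (F v).re) w :=
    Complex.continuous_re.continuousAt.comp hF.self_of_nhds.1.continuousAt
  apply h1.congr
  filter_upwards [hF] with v hv
  exact hv.2.symm

/-! ### Fundamental theorem of calculus along paths -/

lemma carat (f γ θ : ℝ → ℂ) (γ' : ℂ) (t₀ : ℝ) (hγ : HasDerivAt γ γ' t₀) (hθ : ContinuousAt θ t₀)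
    (h : ∀ᶠ t in 𝓝 t₀, f t - f t₀ = (γ t - γ t₀) * θ t) : HasDerivAt f (γ' * θ t₀) t₀ := by
  rw [hasDerivAt_iff_tendsto_slope] at hγ ⊢
  refine (hγ.mul (hθ.tendsto.mono_left nhdsWithin_le_nhds)).congr' ?_
  filter_upwards [h.filter_mono nhdsWithin_le_nhds] with t ht
  simp only [slope_def_module, ht, smul_mul_assoc]

lemma zf_sub (c d : ℝ) (w v : ℂ) (hw : w ≠ 0) (hv : v ≠ 0) :
    zf c d w - zf c d v = d / 2 * ((w - v) * (w * v + 1) / (w * v)) := by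
  unfold zf; field_simp; ring

lemma branch_bound {a b : ℝ} (w₀ : ℂ) (h : Np a b w₀) (hw : w₀ ^ 2 + 1 = 0)
    (F : ℂ → ℂ) (hF : ∀ᶠ v in 𝓝 w₀, HasDerivAt F (Kf a b v) v) :
    ∃ C : ℝ, 0 ≤ C ∧ ∀ᶠ w in 𝓝 w₀, ‖F w - F w₀‖ ≤ C * ‖w - w₀‖ ^ 3 := by
  obtain ⟨h0, h1, h2, h3, h4⟩ := h
  set m : ℂ → ℂ := fun w => (w + w₀) ^ 2 * (a * b) /
    (w * ((w - a) * (a * w + 1)) * ((w - b) * (b * w + 1))) with hm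
  have hmc : ContinuousAt m w₀ := by
    apply ContinuousAt.div
    · fun_prop
    · fun_prop
    · exact mul_ne_zero (mul_ne_zero h0 (mul_ne_zero h1 h2)) (mul_ne_zero h3 h4)
  have hK : ∀ w, Kf a b w = (w - w₀) ^ 2 * m w := by
    intro w
    have e : w ^ 2 + 1 = (w - w₀) * (w + w₀) := by linear_combination hw
    rw [hm]; unfold Kf; rw [e]; ring
  set C := ‖m w₀‖ + 1 with hC
  have hb : ∀ᶠ w in 𝓝 w₀, ‖m w‖ < C := by
    apply hmc.norm.eventually_lt_const
    linarith
  obtain ⟨r, hr, hball⟩ := Metric.eventually_nhds_iff_ball.mp (hF.and hb)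
  refine ⟨C, by positivity, ?_⟩
  filter_upwards [Metric.ball_mem_nhds w₀ hr] with w hwr
  have hsub : Metric.closedBall w₀ ‖w - w₀‖ ⊆ Metric.ball w₀ r := by
    apply Metric.closedBall_subset_ball
    rwa [Metric.mem_ball, dist_eq_norm] at hwr
  have := (convex_closedBall w₀ ‖w - w₀‖).norm_image_sub_le_of_norm_hasDerivWithin_le
    (f := F) (f' := Kf a b) (C := C * ‖w - w₀‖ ^ 2) (x := w₀) (y := w)
    (fun x hx => (hball x (hsub hx)).1.hasDerivWithinAt) ?_ ?_ ?_
  · calc _ ≤ _ := this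
      _ = _ := by ring
  · intro x hx
    have h5 := (hball x (hsub hx)).2
    rw [Metric.mem_closedBall, dist_eq_norm] at hx
    rw [hK, norm_mul, norm_pow, mul_comm]
    gcongr
  · simp
  · simp [dist_eq_norm]

lemma Kf_zf {c d a b : ℝ} (P : Par c d a b) (w : ℂ) (h : Np a b w) (hw : w ^ 2 + 1 ≠ 0) :
    (d / 2 * ((w * w + 1) / (w * w)))⁻¹ * Kf a b w = gf d w / (zf c d w ^ 2 - 1) := by
  have e : zf c d w ^ 2 - 1 = (zf c d w - 1) * (zf c d w + 1) := by ring
  obtain ⟨h0, h1, h2, h3, h4⟩ := h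
  have ha : (a : ℂ) ≠ 0 := by exact_mod_cast P.a0.ne'
  have hb : (b : ℂ) ≠ 0 := by exact_mod_cast P.b0.ne
  have hd : (d : ℂ) ≠ 0 := by exact_mod_cast P.d0.ne'
  rw [e, zf_sub_one P w h0, zf_add_one P w h0]
  unfold Kf gf
  have e2 : w + w⁻¹ = (w ^ 2 + 1) / w := by field_simp
  have e3 : w * w + 1 = w ^ 2 + 1 := by ring
  rw [e2, e3]
  generalize (a : ℂ) * w + 1 = X at *
  generalize (b : ℂ) * w + 1 = Y at *
  generalize w ^ 2 + 1 = Z at *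
  generalize w - (a : ℂ) = X' at *
  generalize w - (b : ℂ) = Y' at *
  field_simp
  try ring

lemma path_deriv {c d a b : ℝ} (P : Par c d a b) (γ w : ℝ → ℂ) (γ' : ℂ) (t₀ : ℝ)
    (hγ : HasDerivAt γ γ' t₀) (hwc : ContinuousAt w t₀)
    (hN : Np a b (w t₀)) (hz : ∀ᶠ t in 𝓝 t₀, w t ≠ 0 ∧ zf c d (w t) = γ t) :
    HasDerivAt (fun t => Hf a b (w t)) (gf d (w t₀) / (γ t₀ ^ 2 - 1) * γ').re t₀ := by
  have hd : (d : ℂ) ≠ 0 := by exact_mod_cast P.d0.ne'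
  obtain ⟨F, hF⟩ := Hf_loc P (w t₀) hN
  have hz0 := hz.self_of_nhds
  have hw0 := hz0.1
  suffices hs : HasDerivAt (fun t => F (w t)) (gf d (w t₀) / (γ t₀ ^ 2 - 1) * γ') t₀ by
    have h1 : HasDerivAt (fun t => (F (w t)).re) (gf d (w t₀) / (γ t₀ ^ 2 - 1) * γ').re t₀ :=
      Complex.reCLM.hasFDerivAt.comp_hasDerivAt t₀ hs
    apply h1.congr_of_eventuallyEq
    filter_upwards [hwc.eventually hF] with t ht
    exact ht.2
  by_cases hb : w t₀ ^ 2 + 1 = 0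
  · obtain ⟨C, hC, hbd⟩ := branch_bound (w t₀) hN hb F (hF.mono fun _ h => h.1)
    set θ : ℝ → ℂ := fun t => (F (w t) - F (w t₀)) / (γ t - γ t₀) with hθ
    have hdiff : ∀ t, w t ≠ 0 → zf c d (w t) = γ t →
        γ t - γ t₀ = d / 2 * ((w t - w t₀) ^ 2 / w t) := by
      intro t h1 h2
      rw [← h2, ← hz0.2, zf_sub c d _ _ h1 hw0]
      have : w t * w t₀ + 1 = w t₀ * (w t - w t₀) := by linear_combination hb
      rw [this]; field_simp
    have hg0 : gf d (w t₀) = 0 := by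
      have e2 : w t₀ + (w t₀)⁻¹ = (w t₀ ^ 2 + 1) / w t₀ := by field_simp
      unfold gf; rw [e2, hb]; simp
    have hθ0 : θ t₀ = 0 := by simp [hθ]
    have hθc : ContinuousAt θ t₀ := by
      rw [ContinuousAt, hθ0]
      have hlim : Tendsto (fun t => 2 * C / d * ‖w t‖ * ‖w t - w t₀‖) (𝓝 t₀) (𝓝 0) := by
        have : ContinuousAt (fun t => 2 * C / d * ‖w t‖ * ‖w t - w t₀‖) t₀ := by fun_prop
        simpa [ContinuousAt] using this
      apply squeeze_zero_norm' _ hlim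
      filter_upwards [hwc.eventually hbd, hz] with t h1 h2
      by_cases he : w t = w t₀
      · simp [hθ, he]
      have hn : 0 < ‖w t - w t₀‖ := norm_pos_iff.mpr (sub_ne_zero.mpr he)
      have hn2 : 0 < ‖w t‖ := norm_pos_iff.mpr h2.1
      have hd0 := P.d0
      rw [hθ]
      simp only
      rw [hdiff t h2.1 h2.2, norm_div, norm_mul, norm_div, norm_div, norm_pow]
      simp only [Complex.norm_real, Real.norm_eq_abs, abs_of_pos hd0, Complex.norm_ofNat]
      rw [div_le_iff₀ (by positivity)]
      calc _ ≤ _ := h1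
        _ = _ := by field_simp
    have := carat (fun t => F (w t)) γ θ γ' t₀ hγ hθc ?_
    · rw [hθ0, mul_zero] at this
      rwa [hg0, zero_div, zero_mul]
    · filter_upwards [hz] with t h2
      by_cases he : w t = w t₀
      · have : γ t = γ t₀ := by rw [← h2.2, ← hz0.2, he]
        simp [he, this]
      · have : γ t - γ t₀ ≠ 0 := by
          rw [hdiff t h2.1 h2.2]
          exact mul_ne_zero (div_ne_zero hd two_ne_zero)
            (div_ne_zero (pow_ne_zero 2 (sub_ne_zero.mpr he)) h2.1)
        rw [hθ]; field_simp
  · set θ : ℝ → ℂ := fun t => (d / 2 * ((w t * w t₀ + 1) / (w t * w t₀)))⁻¹ with hθ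
    have hb' : w t₀ * w t₀ + 1 ≠ 0 := by rwa [← pow_two]
    have hθc : ContinuousAt θ t₀ := by
      apply ContinuousAt.inv₀
      · apply ContinuousAt.mul (by fun_prop)
        exact ContinuousAt.div (f := fun t => w t * w t₀ + 1) (g := fun t => w t * w t₀)
          (by fun_prop) (by fun_prop) (mul_ne_zero hw0 hw0)
      · simp [hd, hw0, hb']
    have hw' := carat w γ θ γ' t₀ hγ hθc ?_
    · have := hF.self_of_nhds.1.comp t₀ hw'
      have e : gf d (w t₀) / (γ t₀ ^ 2 - 1) * γ' = Kf a b (w t₀) * (γ' * θ t₀) := by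
        rw [← hz0.2, ← Kf_zf P (w t₀) hN hb]
        ring
      rw [e]
      exact this
    · have hc : ContinuousAt (fun t => w t * w t₀ + 1) t₀ := by fun_prop
      filter_upwards [hz, hc.eventually_ne hb'] with t h2 h3
      have h21 := h2.1
      rw [← h2.2, ← hz0.2, zf_sub c d _ _ h2.1 hw0, hθ]
      simp only
      generalize w t * w t₀ + 1 = X at *
      field_simp

lemma ftc {c d a b : ℝ} (P : Par c d a b) (γ g : ℝ → ℂ) (hγ : ContDiff ℝ 1 γ)
    (h0 : γ 0 = c - d * I) (hne : ∀ t ∈ Icc (0:ℝ) 1, γ t ≠ 1 ∧ γ t ≠ -1)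
    (hg : ContinuousOn g (Icc 0 1)) (hsq : ∀ t ∈ Icc (0:ℝ) 1, g t ^ 2 = (γ t - c) ^ 2 + d ^ 2) :
    (∫ t in (0:ℝ)..1, g t / ((γ t) ^ 2 - 1) * deriv γ t).re = Hf a b ((γ 1 - c + g 1) / d) := by
  have hd : (d : ℂ) ≠ 0 := by exact_mod_cast P.d0.ne'
  set w : ℝ → ℂ := fun t => (γ t - c + g t) / d with hw
  have hspec := fun t (ht : t ∈ Icc (0:ℝ) 1) => w_spec c d P.d0.ne' (γ t) (g t) (hsq t ht)
  have hN : ∀ t ∈ Icc (0:ℝ) 1, Np a b (w t) := by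
    intro t ht
    obtain ⟨h1, h2, -⟩ := hspec t ht
    rw [hw, Np_iff P _ h1, h2]
    exact hne t ht
  have hγc := hγ.continuous
  have hwc : ContinuousOn w (Icc 0 1) := by
    rw [hw]; fun_prop
  have hint : ContinuousOn (fun t => g t / ((γ t) ^ 2 - 1) * deriv γ t) (Icc 0 1) := by
    have hd' : Continuous (deriv γ) := hγ.continuous_deriv (by norm_num)
    apply ContinuousOn.mul _ hd'.continuousOn
    apply ContinuousOn.div hg (by fun_prop)
    intro t ht h
    have : (γ t - 1) * (γ t + 1) = 0 := by linear_combination h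
    rcases mul_eq_zero.mp this with h1 | h1
    · exact (hne t ht).1 (sub_eq_zero.mp h1)
    · exact (hne t ht).2 (eq_neg_of_add_eq_zero_left h1)
  have hii : IntervalIntegrable (fun t => g t / ((γ t) ^ 2 - 1) * deriv γ t) MeasureTheory.volume 0 1 := by
    apply ContinuousOn.intervalIntegrable
    rwa [uIcc_of_le zero_le_one]
  have hre : (∫ t in (0:ℝ)..1, g t / ((γ t) ^ 2 - 1) * deriv γ t).re =
      ∫ t in (0:ℝ)..1, (g t / ((γ t) ^ 2 - 1) * deriv γ t).re :=
    (Complex.reCLM.intervalIntegral_comp_comm hii).symm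
  rw [hre]
  have hHc : ContinuousOn (fun t => Hf a b (w t)) (Icc 0 1) := by
    intro t ht
    exact (Hf_cont P _ (hN t ht)).comp_continuousWithinAt (hwc t ht)
  have := intervalIntegral.integral_eq_sub_of_hasDerivAt_of_le (a := 0) (b := 1) zero_le_one hHc
    (f' := fun t => (g t / ((γ t) ^ 2 - 1) * deriv γ t).re) ?_ ?_
  · rw [this]
    have hg0 : g 0 = 0 := by
      have := hsq 0 (by simp)
      rw [h0] at this
      have h3 : g 0 ^ 2 = 0 := by rw [this]; linear_combination (d:ℂ) ^ 2 * Complex.I_mul_I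
      exact pow_eq_zero_iff (two_ne_zero) |>.mp h3
    have hw0 : w 0 = -I := by
      simp only [hw, h0, hg0]; field_simp; ring
    simp only [hw0, Hf_negI, sub_zero]
    rfl
  · intro t ht
    have htI : t ∈ Icc (0:ℝ) 1 := Ioo_subset_Icc_self ht
    have hnb : Icc (0:ℝ) 1 ∈ 𝓝 t := Icc_mem_nhds ht.1 ht.2
    have := path_deriv P γ w (deriv γ t) t
      ((hγ.differentiable (by norm_num)) t).hasDerivAt (hwc.continuousAt hnb) (hN t htI) ?_
    · rwa [(hspec t htI).2.2] at this
    · filter_upwards [hnb] with s hs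
      exact ⟨(hspec s hs).1, (hspec s hs).2.1⟩
  · apply ContinuousOn.intervalIntegrable
    rw [uIcc_of_le zero_le_one]
    exact Complex.continuous_re.comp_continuousOn hint

/-! ### Description of `Γ` -/

lemma gamma_H {A B c d a b : ℝ} (P : Par c d a b) (hP : zetaP A B = c + d * I)
    (hM : zetaM A B = c - d * I) (w : ℂ) (hw : w ≠ 0) (hz : zf c d w ∈ GammaSet A B) :
    Np a b w ∧ Hf a b w = 0 := by
  obtain ⟨γ, g, hγ, h0, h1, hne, hg, hsq, hint⟩ := hz
  have hsq' : ∀ t ∈ Icc (0:ℝ) 1, g t ^ 2 = (γ t - c) ^ 2 + d ^ 2 := by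
    intro t ht
    rw [hsq t ht, hP, hM]
    linear_combination -(d:ℂ) ^ 2 * Complex.I_mul_I
  have h1I : (1:ℝ) ∈ Icc (0:ℝ) 1 := by simp
  rw [ftc P γ g hγ (by rw [h0, hM]) hne hg hsq'] at hint
  obtain ⟨e1, e2, e3⟩ := w_spec c d P.d0.ne' (γ 1) (g 1) (hsq' 1 h1I)
  set v := (γ 1 - c + g 1) / d with hv
  have hNw : Np a b w := by
    rw [Np_iff P w hw, ← h1]; exact hne 1 h1I
  have hNv : Np a b v := by
    rw [Np_iff P v e1, e2]; exact hne 1 h1I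
  refine ⟨hNw, ?_⟩
  rcases zf_inj c d P.d0.ne' w v hw e1 (by rw [e2, h1]) with h | h
  · rw [h, hint]
  · rw [h, Hf_anti a b v hNv, hint, neg_zero]

lemma Np_open_conn (a b : ℝ) : IsOpen {w | Np a b w} ∧ IsPreconnected {w | Np a b w} := by
  have e : {w | Np a b w} =
      ({0, (a:ℂ), -(a:ℂ)⁻¹, (b:ℂ), -(b:ℂ)⁻¹} : Set ℂ)ᶜ ∪ {w | Np a b w} := by
    apply (union_eq_right.mpr _).symm
    intro w hw
    simp only [mem_compl_iff, mem_insert_iff, mem_singleton_iff, not_or] at hw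
    obtain ⟨h0, h1, h2, h3, h4⟩ := hw
    refine ⟨h0, sub_ne_zero.mpr h1, ?_, sub_ne_zero.mpr h3, ?_⟩
    · intro h
      have ha : (a:ℂ) ≠ 0 := by rintro ha; simp [ha] at h
      apply h2; field_simp; linear_combination h
    · intro h
      have ha : (b:ℂ) ≠ 0 := by rintro ha; simp [ha] at h
      apply h4; field_simp; linear_combination h
  constructor
  · unfold Np
    simp only [ofPred_and]
    refine IsOpen.inter ?_ (IsOpen.inter ?_ (IsOpen.inter ?_ (IsOpen.inter ?_ ?_))) <;>
      exact isOpen_ne_fun (by fun_prop) (by fun_prop)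
  · have hfin : ({w | Np a b w}ᶜ : Set ℂ).Finite := by
      apply Set.Finite.subset (s := ({0, (a:ℂ), -(a:ℂ)⁻¹, (b:ℂ), -(b:ℂ)⁻¹} : Set ℂ)) (by simp)
      rw [compl_subset_comm, e]
      exact subset_union_left
    have := hfin.countable.isConnected_compl_of_one_lt_rank (by
      rw [Complex.rank_real_complex]; norm_num)
    rw [compl_compl] at this
    exact this.isPreconnected

lemma im_ne_Np (a b : ℝ) (w : ℂ) (h : w.im ≠ 0) : Np a b w := by
  refine ⟨?_, ?_, ?_, ?_, ?_⟩
  · rintro rfl; simp at h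
  · intro h1; apply h; simpa using congrArg Complex.im h1
  · intro h1
    have h2 := congrArg Complex.im h1
    have h3 := congrArg Complex.re h1
    simp at h2 h3
    rcases h2 with h2 | h2
    · simp [h2] at h3
    · exact h h2
  · intro h1; apply h; simpa using congrArg Complex.im h1
  · intro h1
    have h2 := congrArg Complex.im h1
    have h3 := congrArg Complex.re h1
    simp at h2 h3
    rcases h2 with h2 | h2
    · simp [h2] at h3
    · exact h h2

lemma zf_negI (c d : ℝ) : zf c d (-I) = c - d * I := by
  unfold zf
  rw [inv_neg, Complex.inv_I]; ring

lemma zf_comp_contDiff (c d : ℝ) (w : ℝ → ℂ) (hw : ContDiff ℝ 1 w) (h0 : ∀ t, w t ≠ 0) :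
    ContDiff ℝ 1 (fun t => zf c d (w t)) := by
  have := hw.inv h0
  unfold zf
  fun_prop

lemma H_gamma {A B c d a b : ℝ} (P : Par c d a b) (hP : zetaP A B = c + d * I)
    (hM : zetaM A B = c - d * I) (w : ℂ) (hw : Np a b w) (hH : Hf a b w = 0) :
    zf c d w ∈ GammaSet A B := by
  obtain ⟨hO, hC⟩ := Np_open_conn a b
  have hI : Np a b (-I) := im_ne_Np a b _ (by simp)
  obtain ⟨v, hv, hv0, hv1, hvN⟩ := aux_reach _ hO hC (-I) (fun _ => -I) contDiff_const rfl
    (fun t _ => hI) w hw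
  have hvN' : ∀ t ∈ Icc (0:ℝ) 1, Np a b (v t) := by
    intro t ht
    rcases eq_or_lt_of_le ht.1 with h | h
    · rw [← h, hv0]; exact hI
    · exact hvN t ⟨h, ht.2⟩
  set u : ℝ → ℂ := fun t => v (Real.smoothTransition t) with hu
  have hus : ContDiff ℝ 1 u := hv.comp Real.smoothTransition.contDiff
  have huN : ∀ t, Np a b (u t) := fun t =>
    hvN' _ ⟨Real.smoothTransition.nonneg _, Real.smoothTransition.le_one _⟩
  have hu0 : u 0 = -I := by simp [hu, hv0]
  have hu1 : u 1 = w := by simp [hu, hv1]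
  have hγ := zf_comp_contDiff c d u hus (fun t => (huN t).1)
  have hgc : Continuous (fun t => gf d (u t)) := by
    have h1 := hus.continuous
    have h2 : Continuous (fun t => (u t)⁻¹) := h1.inv₀ (fun t => (huN t).1)
    unfold gf; fun_prop
  have hne : ∀ t ∈ Icc (0:ℝ) 1, zf c d (u t) ≠ 1 ∧ zf c d (u t) ≠ -1 := fun t _ =>
    (Np_iff P _ (huN t).1).mp (huN t)
  have hsq : ∀ t ∈ Icc (0:ℝ) 1, gf d (u t) ^ 2 = (zf c d (u t) - c) ^ 2 + d ^ 2 := fun t _ =>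
    gf_sq c d _ (huN t).1
  refine ⟨fun t => zf c d (u t), fun t => gf d (u t), hγ, ?_, ?_, hne, hgc.continuousOn, ?_, ?_⟩
  · simp only [hu0, zf_negI, hM]
  · simp only [hu1]
  · intro t ht
    rw [hsq t ht, hP, hM]
    linear_combination (d:ℂ) ^ 2 * Complex.I_mul_I
  · rw [ftc P _ _ hγ (by simp only [hu0, zf_negI]) hne hgc.continuousOn hsq,
      w_of_zg c d P.d0.ne', hu1, hH]

/-- `|H|` has no local maximum off the branch points -/
lemma no_local_max {c d a b : ℝ} (P : Par c d a b) (w : ℂ) (h : Np a b w) (hb : w ^ 2 + 1 ≠ 0)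
    (hmax : ∀ᶠ v in 𝓝 w, |Hf a b v| ≤ |Hf a b w|) : False := by
  obtain ⟨F, hF⟩ := Hf_loc P w h
  have hK : Kf a b w ≠ 0 := by
    obtain ⟨h0, h1, h2, h3, h4⟩ := h
    have ha : (a : ℂ) ≠ 0 := by exact_mod_cast P.a0.ne'
    have hb' : (b : ℂ) ≠ 0 := by exact_mod_cast P.b0.ne
    unfold Kf
    exact div_ne_zero (mul_ne_zero (pow_ne_zero 2 hb) (mul_ne_zero ha hb'))
      (mul_ne_zero (mul_ne_zero h0 (mul_ne_zero h1 h2)) (mul_ne_zero h3 h4))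
  have han : AnalyticAt ℂ F w := by
    rw [Complex.analyticAt_iff_eventually_differentiableAt]
    exact hF.mono fun v hv => hv.1.differentiableAt
  have hs : HasStrictDerivAt F (Kf a b w) w := by
    have := han.hasStrictDerivAt
    rwa [hF.self_of_nhds.1.deriv] at this
  have hmap := hs.map_nhds_eq hK
  have h1 : ∀ᶠ v in 𝓝 w, |(F v).re| ≤ |(F w).re| := by
    filter_upwards [hF, hmax] with v hv hm
    rwa [← hv.2, ← hF.self_of_nhds.2]
  have h2 : ∀ᶠ y in 𝓝 (F w), |y.re| ≤ |(F w).re| := by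
    rw [← hmap]; exact h1
  obtain ⟨r, hr, hb2⟩ := Metric.eventually_nhds_iff.mp h2
  have h3 := @hb2 (F w + ((r/2 : ℝ) : ℂ)) (by
    simp only [dist_eq_norm, add_sub_cancel_left, Complex.norm_real, Real.norm_eq_abs]
    rw [abs_of_pos (by linarith)]; linarith)
  have h4 := @hb2 (F w - ((r/2 : ℝ) : ℂ)) (by
    rw [dist_eq_norm, ← norm_neg]
    simp only [neg_sub, sub_sub_cancel, Complex.norm_real, Real.norm_eq_abs]
    rw [abs_of_pos (by linarith)]; linarith)
  simp only [add_re, sub_re, ofReal_re] at h3 h4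
  have h5 := le_abs_self ((F w).re + r/2)
  have h6 := neg_le_abs ((F w).re - r/2)
  rcases abs_cases (F w).re with ⟨h7, -⟩ | ⟨h7, -⟩ <;> linarith

lemma exists_w (c d : ℝ) (hd : d ≠ 0) (z : ℂ) : ∃ w, w ≠ 0 ∧ zf c d w = z := by
  obtain ⟨g, hg⟩ := IsAlgClosed.exists_pow_nat_eq ((z - c) ^ 2 + (d:ℂ) ^ 2) (n := 2) (by norm_num)
  obtain ⟨h1, h2, -⟩ := w_spec c d hd z g hg
  exact ⟨_, h1, h2⟩

lemma w_bound (c d : ℝ) (hd : 0 < d) (M : ℝ) (w : ℂ) (hw : w ≠ 0) (h : ‖zf c d w‖ ≤ M) :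
    ‖w‖ ≤ 2 * (M + |c|) / d + 1 := by
  have hM : 0 ≤ 2 * (M + |c|) / d := by
    have := (norm_nonneg _).trans h
    positivity
  by_cases h1 : ‖w‖ ≤ 1
  · linarith
  push Not at h1
  have hd' : (d:ℂ) ≠ 0 := by exact_mod_cast hd.ne'
  have e : w = 2 * (zf c d w - c) / d + w⁻¹ := by
    unfold zf; field_simp; ring
  have h2 : ‖w⁻¹‖ ≤ 1 := by
    rw [norm_inv]; exact inv_le_one_of_one_le₀ h1.le
  calc ‖w‖ = ‖2 * (zf c d w - c) / d + w⁻¹‖ := by rw [← e]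
    _ ≤ ‖2 * (zf c d w - c) / d‖ + ‖w⁻¹‖ := norm_add_le _ _
    _ ≤ 2 * (M + |c|) / d + 1 := by
      gcongr
      rw [norm_div, norm_mul]
      simp only [Complex.norm_ofNat, Complex.norm_real, Real.norm_eq_abs, abs_of_pos hd]
      gcongr
      calc _ ≤ ‖zf c d w‖ + ‖(c:ℂ)‖ := norm_sub_le _ _
        _ ≤ _ := by simpa using h

lemma zf_neg_inv (c d : ℝ) (w : ℂ) : zf c d (-w⁻¹) = zf c d w := by
  unfold zf
  rw [inv_neg, inv_inv]; ring

/-- The complement of `Γ_C` has no bounded component. -/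
lemma comp_unbounded {A B c d a b : ℝ} (P : Par c d a b) (hP : zetaP A B = c + d * I)
    (hM : zetaM A B = c - d * I) (ΓC : Set ℂ) (hΓC : IsCenterArc A B ΓC) (z : ℂ) (hz : z ∉ ΓC) :
    ¬ IsBounded (connectedComponentIn ΓCᶜ z) := by
  intro hbd
  obtain ⟨hcomp, -, hzP, hzM, hsub, hreal⟩ := hΓC
  have hd : (d : ℂ) ≠ 0 := by exact_mod_cast P.d0.ne'
  set V := connectedComponentIn ΓCᶜ z with hV
  have hOc : IsOpen ΓCᶜ := hcomp.isClosed.isOpen_compl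
  have hVo : IsOpen V := hOc.connectedComponentIn
  have hzV : z ∈ V := mem_connectedComponentIn hz
  have hVs : V ⊆ ΓCᶜ := connectedComponentIn_subset _ _
  have hcl : ∀ y ∈ closure V, y ∉ V → y ∈ ΓC := by
    intro y hy hyV
    by_contra hyc
    have hyo : IsOpen (connectedComponentIn ΓCᶜ y) := hOc.connectedComponentIn
    obtain ⟨x, hx1, hx2⟩ := mem_closure_iff.mp hy _ hyo (mem_connectedComponentIn hyc)
    have e1 := connectedComponentIn_eq hx1
    have e2 := connectedComponentIn_eq hx2
    apply hyV
    rw [hV, e2, ← e1]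
    exact mem_connectedComponentIn hyc
  have h1V : (1:ℂ) ∉ V := by
    intro h1
    have hray : (fun x : ℝ => (x:ℂ)) '' Ici 1 ⊆ V := by
      have hpc : IsPreconnected ((fun x : ℝ => (x:ℂ)) '' Ici 1) :=
        isPreconnected_Ici.image _ (by fun_prop)
      have e := connectedComponentIn_eq h1
      rw [hV, e]
      apply hpc.subset_connectedComponentIn ⟨1, by simp, by simp⟩
      rintro _ ⟨x, hx, rfl⟩ hxc
      have := (hreal _ hxc (by simp)).2
      simp at this hx; linarith
    obtain ⟨M, hM'⟩ := hbd.exists_norm_le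
    have := hM' _ (hray ⟨max 1 (M+1), by simp, rfl⟩)
    rw [Complex.norm_real, Real.norm_eq_abs] at this
    linarith [le_abs_self (max 1 (M+1)), le_max_right 1 (M+1)]
  have h2V : (-1:ℂ) ∉ V := by
    intro h1
    have hray : (fun x : ℝ => (x:ℂ)) '' Iic (-1) ⊆ V := by
      have hpc : IsPreconnected ((fun x : ℝ => (x:ℂ)) '' Iic (-1)) :=
        isPreconnected_Iic.image _ (by fun_prop)
      have e := connectedComponentIn_eq h1
      rw [hV, e]
      apply hpc.subset_connectedComponentIn ⟨-1, by simp, by simp⟩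
      rintro _ ⟨x, hx, rfl⟩ hxc
      have := (hreal _ hxc (by simp)).1
      simp at this hx; linarith
    obtain ⟨M, hM'⟩ := hbd.exists_norm_le
    have := hM' _ (hray ⟨min (-1) (-M-1), by simp, rfl⟩)
    rw [Complex.norm_real, Real.norm_eq_abs] at this
    linarith [neg_le_abs (min (-1) (-M-1)), min_le_right (-1) (-M-1)]
  -- the lifted compact set
  obtain ⟨M, hMb⟩ := hbd.closure.exists_norm_le
  set C := 2 * (M + |c|) / d + 1 with hC
  set K : Set ℂ := (Metric.closedBall 0 C \ Metric.ball 0 C⁻¹) ∩ zf c d ⁻¹' closure V with hK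
  have hMn : 0 ≤ M := (norm_nonneg z).trans (hMb z (subset_closure hzV))
  have hCpos : 0 < C := by
    have := P.d0
    positivity
  have hmemK : ∀ w, w ≠ 0 → zf c d w ∈ closure V → w ∈ K := by
    intro w hw hwV
    have h1 := w_bound c d P.d0 M w hw (hMb _ hwV)
    have h2 := w_bound c d P.d0 M (-w⁻¹) (by simpa using hw) (by rw [zf_neg_inv]; exact hMb _ hwV)
    rw [norm_neg, norm_inv] at h2
    refine ⟨⟨by simpa using h1, ?_⟩, hwV⟩
    simp only [Metric.mem_ball, dist_zero_right, not_lt]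
    exact inv_le_of_inv_le₀ (norm_pos_iff.mpr hw) h2
  have hK0 : ∀ w ∈ K, w ≠ 0 := by
    rintro w ⟨⟨-, h1⟩, -⟩ rfl
    apply h1; simpa using hCpos
  have hKc : IsCompact K := by
    have hann : IsCompact (Metric.closedBall (0:ℂ) C \ Metric.ball 0 C⁻¹) :=
      (isCompact_closedBall 0 C).diff Metric.isOpen_ball
    apply hann.of_isClosed_subset _ inter_subset_left
    apply ContinuousOn.preimage_isClosed_of_isClosed _ hann.isClosed isClosed_closure
    have h0 : ∀ w ∈ Metric.closedBall (0:ℂ) C \ Metric.ball 0 C⁻¹, w ≠ 0 := by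
      rintro w ⟨-, h1⟩ rfl
      apply h1; simpa using hCpos
    have h2 : ContinuousOn (fun w : ℂ => w⁻¹) (Metric.closedBall (0:ℂ) C \ Metric.ball 0 C⁻¹) :=
      continuousOn_id.inv₀ h0
    unfold zf; fun_prop
  have hKN : ∀ w ∈ K, Np a b w ∧ (zf c d w ∉ V → Hf a b w = 0) := by
    intro w hw
    by_cases hwV : zf c d w ∈ V
    · refine ⟨?_, fun h => absurd hwV h⟩
      rw [Np_iff P w (hK0 w hw)]
      exact ⟨fun h => h1V (h ▸ hwV), fun h => h2V (h ▸ hwV)⟩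
    · have := gamma_H P hP hM w (hK0 w hw) (hsub (hcl _ hw.2 hwV))
      exact ⟨this.1, fun _ => this.2⟩
  have hbr : ∀ w, w ≠ 0 → zf c d w ∈ V → w ^ 2 + 1 ≠ 0 := by
    intro w hw hwV h
    have h1 : (w - I) * (w + I) = 0 := by linear_combination h - Complex.I_mul_I
    rcases mul_eq_zero.mp h1 with h2 | h2
    · have : w = I := sub_eq_zero.mp h2
      apply hVs hwV
      rw [this]
      have : zf c d I = c + d * I := by unfold zf; rw [Complex.inv_I]; ring
      rw [this, ← hP]; exact hzP
    · have : w = -I := eq_neg_of_add_eq_zero_left h2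
      apply hVs hwV
      rw [this, zf_negI, ← hM]; exact hzM
  have hfin : ∀ w ∈ K, zf c d w ∈ V → (∀ v ∈ K, |Hf a b v| ≤ |Hf a b w|) → False := by
    intro w hw hwV hmax
    apply no_local_max P w (hKN w hw).1 (hbr w (hK0 w hw) hwV)
    have hcz : ContinuousAt (zf c d) w := by
      have : ContinuousAt (fun w : ℂ => w⁻¹) w := continuousAt_inv₀ (hK0 w hw)
      unfold zf; fun_prop
    filter_upwards [hcz.eventually_mem (hVo.mem_nhds hwV), eventually_ne_nhds (hK0 w hw)] with v h1 h2
    exact hmax v (hmemK v h2 (subset_closure h1))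
  obtain ⟨w₁, hw₁, hzw₁⟩ := exists_w c d P.d0.ne' z
  have hw₁V : zf c d w₁ ∈ V := by rw [hzw₁]; exact hzV
  have hw₁K := hmemK w₁ hw₁ (subset_closure hw₁V)
  obtain ⟨w₀, hw₀K, hmax⟩ := hKc.exists_isMaxOn (f := fun w => |Hf a b w|) ⟨w₁, hw₁K⟩ (by
    intro w hw
    exact ((Hf_cont P w (hKN w hw).1).abs).continuousWithinAt)
  by_cases hw₀V : zf c d w₀ ∈ V
  · exact hfin w₀ hw₀K hw₀V (fun v hv => hmax hv)
  · have h0 := (hKN w₀ hw₀K).2 hw₀V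
    apply hfin w₁ hw₁K hw₁V
    intro v hv
    have := hmax hv
    simp only [mem_ofPred_eq, h0, abs_zero] at this
    exact this.trans (abs_nonneg _)

lemma compl_conn {A B c d a b : ℝ} (P : Par c d a b) (hP : zetaP A B = c + d * I)
    (hM : zetaM A B = c - d * I) (ΓC : Set ℂ) (hΓC : IsCenterArc A B ΓC) :
    IsPreconnected ΓCᶜ := by
  obtain ⟨M, hMb⟩ := hΓC.1.isBounded.exists_norm_le
  set r := max M 1 with hr
  have hr0 : 0 < r := lt_of_lt_of_le one_pos (le_max_right _ _)
  have hE := aux_exterior r hr0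
  have hEs : {z : ℂ | r < ‖z‖} ⊆ ΓCᶜ := by
    intro z hz hzc
    have h1 := hMb z hzc
    have h2 : r < ‖z‖ := hz
    linarith [le_max_left M 1]
  have hx : ((r + 1 : ℝ) : ℂ) ∈ {z : ℂ | r < ‖z‖} := by
    change r < ‖((r + 1 : ℝ) : ℂ)‖
    rw [Complex.norm_real, Real.norm_eq_abs]
    linarith [le_abs_self (r+1)]
  apply isPreconnected_of_forall ((r + 1 : ℝ) : ℂ)
  intro y hy
  refine ⟨connectedComponentIn ΓCᶜ y, connectedComponentIn_subset _ _, ?_,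
    mem_connectedComponentIn hy, isPreconnected_connectedComponentIn⟩
  have hub := comp_unbounded P hP hM ΓC hΓC y hy
  have : ∃ x ∈ connectedComponentIn ΓCᶜ y, r < ‖x‖ := by
    by_contra hcon
    push Not at hcon
    exact hub (isBounded_iff_forall_norm_le.mpr ⟨r, hcon⟩)
  obtain ⟨x, hx1, hx2⟩ := this
  have e := connectedComponentIn_eq hx1
  rw [e]
  exact hE.subset_connectedComponentIn hx2 hEs hx

/-! ### A path leaving `ζ₋` -/

lemma start_path {A B c d a b : ℝ} (P : Par c d a b) (hP : zetaP A B = c + d * I)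
    (hM : zetaM A B = c - d * I) :
    ∃ γ : ℝ → ℂ, ContDiff ℝ 1 γ ∧ γ 0 = c - d * I ∧
      ∀ t ∈ Ioc (0:ℝ) 1, γ t ∉ GammaSet A B ∧ γ t ≠ 1 ∧ γ t ≠ -1 := by
  have hI : Np a b (-I) := im_ne_Np a b _ (by simp)
  obtain ⟨F, hF⟩ := Hf_loc P (-I) hI
  obtain ⟨h0, h1, h2, h3, h4⟩ := id hI
  have ha : (a : ℂ) ≠ 0 := by exact_mod_cast P.a0.ne'
  have hb : (b : ℂ) ≠ 0 := by exact_mod_cast P.b0.ne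
  set m : ℂ → ℂ := fun w => (w - I) ^ 2 * (a * b) /
    (w * ((w - a) * (a * w + 1)) * ((w - b) * (b * w + 1))) with hm
  have hmc : ContinuousAt m (-I) := by
    apply ContinuousAt.div
    · fun_prop
    · fun_prop
    · exact mul_ne_zero (mul_ne_zero h0 (mul_ne_zero h1 h2)) (mul_ne_zero h3 h4)
  have hm0 : m (-I) ≠ 0 := by
    apply div_ne_zero
    · apply mul_ne_zero _ (mul_ne_zero ha hb)
      apply pow_ne_zero
      have : -I - I = -2 * I := by ring
      rw [this]; simp
    · exact mul_ne_zero (mul_ne_zero h0 (mul_ne_zero h1 h2)) (mul_ne_zero h3 h4)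
  have hK : ∀ w, Kf a b w = (w + I) ^ 2 * m w := by
    intro w
    have e : w ^ 2 + 1 = (w + I) * (w - I) := by linear_combination Complex.I_mul_I
    rw [hm]; unfold Kf; rw [e]; ring
  obtain ⟨v, hv⟩ := IsAlgClosed.exists_pow_nat_eq ((m (-I))⁻¹) (n := 3) (by norm_num)
  have hline : ContinuousAt (fun s : ℝ => -I + (s:ℂ) * v) 0 := by fun_prop
  have hl0 : -I + ((0:ℝ):ℂ) * v = -I := by simp
  have hmv : ∀ᶠ s : ℝ in 𝓝 0, 0 < (v ^ 3 * m (-I + (s:ℂ) * v)).re := by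
    have hc : ContinuousAt (fun s : ℝ => (v ^ 3 * m (-I + (s:ℂ) * v)).re) 0 := by
      apply Complex.continuous_re.continuousAt.comp
      apply continuousAt_const.mul
      apply ContinuousAt.comp (g := m) _ hline
      rwa [hl0]
    apply hc.eventually_const_lt
    show 0 < (v ^ 3 * m (-I + ((0:ℝ):ℂ) * v)).re
    rw [hl0, hv, inv_mul_cancel₀ hm0]; simp
  have hFl : ∀ᶠ s : ℝ in 𝓝 0, HasDerivAt F (Kf a b (-I + (s:ℂ) * v)) (-I + (s:ℂ) * v) ∧
      Hf a b (-I + (s:ℂ) * v) = (F (-I + (s:ℂ) * v)).re := by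
    have h' : ∀ᶠ y in 𝓝 (-I + ((0:ℝ):ℂ) * v), HasDerivAt F (Kf a b y) y ∧ Hf a b y = (F y).re := by
      rw [hl0]; exact hF
    exact hline.eventually (p := fun y => HasDerivAt F (Kf a b y) y ∧ Hf a b y = (F y).re) h'
  have him : ∀ᶠ s : ℝ in 𝓝 0, (-I + (s:ℂ) * v).im < 0 := by
    have hc : ContinuousAt (fun s : ℝ => (-I + (s:ℂ) * v).im) 0 := by fun_prop
    apply hc.eventually_lt_const
    simp
  obtain ⟨r, hr, hall⟩ := Metric.eventually_nhds_iff_ball.mp (hmv.and (hFl.and him))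
  have hin : ∀ s ∈ Icc (0:ℝ) (r/2), s ∈ Metric.ball (0:ℝ) r := by
    intro s hs
    rw [Metric.mem_ball, dist_zero_right, Real.norm_eq_abs, abs_of_nonneg hs.1]
    linarith [hs.2]
  set φ : ℝ → ℝ := fun s => (F (-I + (s:ℂ) * v)).re with hφ
  have hder : ∀ s ∈ Icc (0:ℝ) (r/2), HasDerivAt φ (s ^ 2 * (v ^ 3 * m (-I + (s:ℂ) * v)).re) s := by
    intro s hs
    have h5 := (hall s (hin s hs)).2.1.1
    have h6 : HasDerivAt (fun s : ℝ => -I + (s:ℂ) * v) v s := by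
      simpa using ((Complex.ofRealCLM.hasDerivAt (x := s)).mul_const v).const_add (-I)
    have h7 : HasDerivAt (fun s : ℝ => F (-I + (s:ℂ) * v)) (Kf a b (-I + (s:ℂ) * v) * v) s :=
      HasDerivAt.comp (h := fun s : ℝ => -I + (s:ℂ) * v) s h5 h6
    have h8 : HasDerivAt φ (Kf a b (-I + (s:ℂ) * v) * v).re s :=
      Complex.reCLM.hasFDerivAt.comp_hasDerivAt s h7
    have e : (Kf a b (-I + (s:ℂ) * v) * v) = ((s ^ 2 : ℝ) : ℂ) * (v ^ 3 * m (-I + (s:ℂ) * v)) := by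
      rw [hK]; push_cast; ring
    rwa [e, Complex.re_ofReal_mul] at h8
  have hmono : StrictMonoOn φ (Icc 0 (r/2)) := by
    apply strictMonoOn_of_deriv_pos (convex_Icc _ _)
    · exact fun s hs => (hder s hs).continuousAt.continuousWithinAt
    · intro s hs
      rw [interior_Icc] at hs
      have hs' := Ioo_subset_Icc_self hs
      rw [(hder s hs').deriv]
      exact mul_pos (pow_pos hs.1 2) (hall s (hin s hs')).1
  have hφ0 : φ 0 = 0 := by
    have := (hall 0 (hin 0 ⟨le_rfl, by linarith⟩)).2.1.2
    rw [hl0, Hf_negI] at this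
    rw [hφ]; simp only [hl0]; exact this.symm
  set w : ℝ → ℂ := fun t => -I + ((r/2 * Real.smoothTransition t : ℝ) : ℂ) * v with hw
  have hran : ∀ t, r/2 * Real.smoothTransition t ∈ Icc (0:ℝ) (r/2) := by
    intro t
    have e1 := Real.smoothTransition.nonneg t
    have e2 := Real.smoothTransition.le_one t
    constructor
    · positivity
    · nlinarith
  have hNw : ∀ t, Np a b (w t) := fun t =>
    im_ne_Np a b _ (hall _ (hin _ (hran t))).2.2.ne
  refine ⟨fun t => zf c d (w t), ?_, ?_, ?_⟩
  · apply zf_comp_contDiff c d w _ (fun t => (hNw t).1)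
    have h5 : ContDiff ℝ 1 (fun t => r/2 * Real.smoothTransition t) :=
      contDiff_const.mul Real.smoothTransition.contDiff
    have h6 : ContDiff ℝ 1 (fun t => ((r/2 * Real.smoothTransition t : ℝ) : ℂ)) :=
      Complex.ofRealCLM.contDiff.comp h5
    exact contDiff_const.add (h6.mul contDiff_const)
  · have : w 0 = -I := by simp [hw]
    simp only [this, zf_negI]
  · intro t ht
    refine ⟨fun hG => ?_, (Np_iff P _ (hNw t).1).mp (hNw t)⟩
    have h5 := (gamma_H P hP hM (w t) (hNw t).1 hG).2
    have h6 := hmono (show (0:ℝ) ∈ Icc 0 (r/2) from ⟨le_rfl, by linarith⟩) (hran t)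
      (mul_pos (by linarith) (Real.smoothTransition.pos_of_pos ht.1))
    rw [hφ0] at h6
    have h7 := (hall _ (hin _ (hran t))).2.1.2
    have h8 : Hf a b (w t) = φ (r/2 * Real.smoothTransition t) := h7
    linarith

/-! ### Square roots -/

def csq (y : ℂ) : ℂ := Complex.exp (Complex.log y / 2)

lemma csq_sq (y : ℂ) (h : y ≠ 0) : csq y ^ 2 = y := by
  unfold csq
  rw [← Complex.exp_nat_mul]
  have : ((2:ℕ):ℂ) * (Complex.log y / 2) = Complex.log y := by push_cast; ring
  rw [this, Complex.exp_log h]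

lemma csq_cont (y : ℂ) (h : y ∈ slitPlane) : ContinuousAt csq y := by
  unfold csq
  apply Complex.continuous_exp.continuousAt.comp
  exact (continuousAt_clog h).div_const 2

lemma csq_re (y : ℂ) (h : y ∈ slitPlane) : 0 < (csq y).re := by
  unfold csq
  rw [Complex.exp_re]
  apply mul_pos (Real.exp_pos _)
  have e : (Complex.log y / 2).im = y.arg / 2 := by
    have : Complex.log y / 2 = ((1/2 : ℝ) : ℂ) * Complex.log y := by push_cast; ring
    rw [this, Complex.im_ofReal_mul, Complex.log_im]; ring
  rw [e]
  have h1 := Complex.neg_pi_lt_arg y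
  have h2 := (Complex.mem_slitPlane_iff_arg.mp h).1
  have h3 : y.arg < Real.pi := lt_of_le_of_ne (Complex.arg_le_pi y) h2
  apply Real.cos_pos_of_mem_Ioo
  constructor <;> linarith

lemma csq_conj (y : ℂ) (h : y ∈ slitPlane) :
    csq ((starRingEnd ℂ) y) = (starRingEnd ℂ) (csq y) := by
  unfold csq
  rw [Complex.log_conj y (Complex.mem_slitPlane_iff_arg.mp h).1, ← Complex.exp_conj, map_div₀, Complex.conj_ofNat]

/-! ### Rays avoiding `Γ` -/

lemma Hf_conj (a b : ℝ) (w : ℂ) : Hf a b ((starRingEnd ℂ) w) = Hf a b w := by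
  have e1 (x : ℝ) : ‖(starRingEnd ℂ) w - x‖ = ‖w - x‖ := by
    rw [← Complex.norm_conj]; simp
  have e2 (x : ℝ) : ‖x * (starRingEnd ℂ) w + 1‖ = ‖x * w + 1‖ := by
    rw [← Complex.norm_conj]; simp
  unfold Hf
  rw [e1, e1, e2, e2, Complex.norm_conj]

lemma zf_conj (c d : ℝ) (w : ℂ) : zf c d ((starRingEnd ℂ) w) = (starRingEnd ℂ) (zf c d w) := by
  unfold zf; simp [Complex.conj_ofNat]

lemma Hf_I (a b : ℝ) : Hf a b I = 0 := by
  have := Hf_conj a b I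
  rw [Complex.conj_I, Hf_negI] at this
  exact this.symm

lemma ray_avoid {A B c d a b : ℝ} (P : Par c d a b) (hP : zetaP A B = c + d * I)
    (hM : zetaM A B = c - d * I) (u : ℂ) (hu : u * (starRingEnd ℂ) u = 1)
    (hslit : ∀ s : ℝ, 0 ≤ s → (s + 2 * I * d * (starRingEnd ℂ) u : ℂ) ∈ slitPlane)
    (him : ∀ s : ℝ, 0 ≤ s → (c + d * I + s * u : ℂ).im ≠ 0)
    (hpos : ∀ s : ℝ, 0 < s → 0 < (u ^ 2 * csq ((s:ℂ) + 2 * I * d * (starRingEnd ℂ) u) /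
      (((c:ℂ) + d * I + s * u) ^ 2 - 1)).re) (s : ℝ) (hs : 0 < s) :
    (c + d * I + s * u : ℂ) ∉ GammaSet A B ∧
    (starRingEnd ℂ) (c + d * I + s * u : ℂ) ∉ GammaSet A B := by
  have hd : (d : ℂ) ≠ 0 := by exact_mod_cast P.d0.ne'
  set γ : ℝ → ℂ := fun s => c + d * I + s * u with hγ
  set X : ℝ → ℂ := fun s => csq ((s:ℂ) + 2 * I * d * (starRingEnd ℂ) u) with hX
  set g : ℝ → ℂ := fun s => (Real.sqrt s : ℂ) * u * X s with hg
  set w : ℝ → ℂ := fun s => (γ s - c + g s) / d with hw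
  have hXc : ∀ s, 0 ≤ s → ContinuousAt X s := by
    intro s hs
    exact ContinuousAt.comp (g := csq) (f := fun s : ℝ => (s:ℂ) + 2 * I * d * (starRingEnd ℂ) u)
      (csq_cont _ (hslit s hs)) (by fun_prop)
  have hgc : ∀ s, 0 ≤ s → ContinuousAt g s := by
    intro s hs
    have h1 := hXc s hs
    have h2 : ContinuousAt (fun s : ℝ => (Real.sqrt s : ℂ)) s :=
      (Complex.continuous_ofReal.comp Real.continuous_sqrt).continuousAt
    exact (h2.mul continuousAt_const).mul h1
  have hwc : ∀ s, 0 ≤ s → ContinuousAt w s := by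
    intro s hs
    have h1 := hgc s hs
    rw [hw, hγ]
    fun_prop
  have hsq : ∀ s, 0 ≤ s → g s ^ 2 = (γ s - c) ^ 2 + d ^ 2 := by
    intro s hs
    have h1 : X s ^ 2 = _ := csq_sq _ (slitPlane_ne_zero (hslit s hs))
    have h2 : (Real.sqrt s : ℂ) ^ 2 = s := by
      rw [← Complex.ofReal_pow, Real.sq_sqrt hs]
    have h3 : g s ^ 2 = (Real.sqrt s : ℂ) ^ 2 * u ^ 2 * X s ^ 2 := by rw [hg]; ring
    rw [h3, h2, h1, hγ]
    linear_combination (2 * I * d * s * u) * hu - (d:ℂ) ^ 2 * Complex.I_mul_I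
  have hspec := fun s (hs : 0 ≤ s) => w_spec c d P.d0.ne' (γ s) (g s) (hsq s hs)
  have hN : ∀ s, 0 ≤ s → Np a b (w s) := by
    intro s hs
    obtain ⟨h1, h2, -⟩ := hspec s hs
    rw [hw, Np_iff P _ h1, h2]
    constructor
    · intro h; apply him s hs; have := congrArg Complex.im h; simpa [hγ] using this
    · intro h; apply him s hs; have := congrArg Complex.im h; simpa [hγ] using this
  have hder : ∀ s, 0 < s → HasDerivAt (fun s => Hf a b (w s)) (g s / (γ s ^ 2 - 1) * u).re s := by
    intro s hs
    have h1 : HasDerivAt γ u s := by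
      have h0 := ((Complex.ofRealCLM.hasDerivAt (x := s)).mul_const u).const_add ((c:ℂ) + d * I)
      have e : Complex.ofRealCLM 1 * u = u := by simp
      rw [e] at h0
      exact h0
    have := path_deriv P γ w u s h1 (hwc s hs.le) (hN s hs.le) ?_
    · rwa [(hspec s hs.le).2.2] at this
    · filter_upwards [lt_mem_nhds hs] with t ht
      exact ⟨(hspec t ht.le).1, (hspec t ht.le).2.1⟩
  have hmono : StrictMonoOn (fun s => Hf a b (w s)) (Ici 0) := by
    apply strictMonoOn_of_deriv_pos (convex_Ici _)
    · intro s hs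
      exact ((Hf_cont P _ (hN s hs)).comp (hwc s hs)).continuousWithinAt
    · intro s hs
      rw [interior_Ici] at hs
      have hs0 : 0 < s := hs
      rw [(hder s hs0).deriv]
      have e : g s / (γ s ^ 2 - 1) * u = ((Real.sqrt s : ℝ) : ℂ) *
          (u ^ 2 * csq ((s:ℂ) + 2 * I * d * (starRingEnd ℂ) u) / (((c:ℂ) + d * I + s * u) ^ 2 - 1)) := by
        rw [hg, hγ, hX]; ring
      rw [e, Complex.re_ofReal_mul]
      exact mul_pos (Real.sqrt_pos.mpr hs0) (hpos s hs0)
  have h0 : Hf a b (w 0) = 0 := by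
    have : w 0 = I := by
      simp only [hw, hγ, hg]; simp; field_simp
    rw [this, Hf_I]
  have hp : 0 < Hf a b (w s) := by
    have := hmono (show (0:ℝ) ∈ Ici 0 by simp) (show s ∈ Ici 0 from hs.le) hs
    simpa [h0] using this
  have hz := (hspec s hs.le).2.1
  constructor
  · intro hG
    have hG' : zf c d (w s) ∈ GammaSet A B := by
      rw [hw]; simp only; rw [hz]; exact hG
    linarith [(gamma_H P hP hM (w s) (hN s hs.le).1 hG').2]
  · intro hG
    have hG' : zf c d ((starRingEnd ℂ) (w s)) ∈ GammaSet A B := by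
      rw [zf_conj, hw]; simp only; rw [hz]; exact hG
    have := (gamma_H P hP hM _ (by simpa using (hN s hs.le).1) hG').2
    rw [Hf_conj] at this
    linarith

/-- a direction exists -/
lemma exists_ray {A B c d a b : ℝ} (P : Par c d a b) (hP : zetaP A B = c + d * I)
    (hM : zetaM A B = c - d * I) : ∃ u : ℂ, u * (starRingEnd ℂ) u = 1 ∧
    (∀ s : ℝ, 0 ≤ s → (c + d * I + s * u : ℂ).im ≠ 0) ∧
    ∀ s : ℝ, 0 < s → (c + d * I + s * u : ℂ) ∉ GammaSet A B ∧
    (starRingEnd ℂ) (c + d * I + s * u : ℂ) ∉ GammaSet A B := by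
  have hd0 := P.d0
  by_cases hcd : c ^ 2 ≤ 1 + d ^ 2
  · have him : ∀ s : ℝ, 0 ≤ s → (c + d * I + s * I : ℂ).im ≠ 0 := by
      intro s hs; simp; linarith
    refine ⟨I, by simp, him, ray_avoid P hP hM I (by simp) ?_ him ?_⟩
    · intro s hs
      left
      simp; linarith
    · intro s hs
      have e : (s + 2 * I * d * (starRingEnd ℂ) I : ℂ) = ((s + 2 * d : ℝ) : ℂ) := by
        rw [Complex.conj_I]; push_cast; linear_combination (-2 * d : ℂ) * Complex.I_mul_I
      have hX : csq ((s:ℂ) + 2 * I * d * (starRingEnd ℂ) I) = ((Real.exp (Real.log (s + 2 * d) / 2) : ℝ) : ℂ) := by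
        rw [e]; unfold csq
        rw [← Complex.ofReal_log (by linarith)]; push_cast; rfl
      rw [hX, Complex.I_sq]
      have e2 : (-1 * ((Real.exp (Real.log (s + 2 * d) / 2) : ℝ) : ℂ) / (((c:ℂ) + d * I + s * I) ^ 2 - 1)) =
        ((Real.exp (Real.log (s + 2 * d) / 2) : ℝ) : ℂ) * (-(((c:ℂ) + d * I + s * I) ^ 2 - 1)⁻¹) := by
        ring
      rw [e2, Complex.re_ofReal_mul]
      apply mul_pos (Real.exp_pos _)
      rw [Complex.neg_re, Complex.inv_re, ← neg_div]
      have e3 : (((c:ℂ) + d * I + s * I : ℂ) ^ 2 - 1).re = c ^ 2 - (d + s) ^ 2 - 1 := by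
        simp [pow_two]
      have hneg : c ^ 2 - (d + s) ^ 2 - 1 < 0 := by nlinarith
      apply div_pos
      · rw [e3]; linarith
      · apply Complex.normSq_pos.mpr
        intro h; rw [h] at e3; simp at e3; linarith
  · push Not at hcd
    obtain ⟨k, hk, hkc⟩ : ∃ k : ℝ, k ^ 2 = 1 ∧ 0 ≤ k * c := by
      rcases le_total 0 c with h | h
      · exact ⟨1, by norm_num, by linarith⟩
      · exact ⟨-1, by norm_num, by linarith⟩
    have hkC : (k:ℂ) ^ 2 = 1 := by exact_mod_cast hk
    have him : ∀ s : ℝ, 0 ≤ s → (c + d * I + s * (k:ℂ) : ℂ).im ≠ 0 := by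
      intro s hs; simp; exact hd0.ne'
    have hkne : k ≠ 0 := by rintro rfl; norm_num at hk
    have hsl : ∀ s : ℝ, 0 ≤ s → (s + 2 * I * d * (starRingEnd ℂ) (k:ℂ) : ℂ) ∈ slitPlane := by
      intro s hs
      right
      simp [hd0.ne', hkne]
    have hkk : (k:ℂ) * (starRingEnd ℂ) (k:ℂ) = 1 := by rw [Complex.conj_ofReal, ← pow_two, hkC]
    refine ⟨k, hkk, him, ray_avoid P hP hM k hkk hsl him ?_⟩
    intro s hs
    have h1 := csq_re _ (hsl s hs.le)
    have h2 := csq_sq _ (slitPlane_ne_zero (hsl s hs.le))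
    set X := csq ((s:ℂ) + 2 * I * d * (starRingEnd ℂ) (k:ℂ)) with hX
    have h3 : 2 * X.re * X.im = 2 * d * k := by
      have := congrArg Complex.im h2
      simp [pow_two] at this
      linarith
    rw [hkC, one_mul, Complex.div_re]
    set Y := (c + d * I + s * (k:ℂ) : ℂ) ^ 2 - 1 with hY
    have hYr : Y.re = (c + s * k) ^ 2 - d ^ 2 - 1 := by simp [hY, pow_two]
    have hYi : Y.im = 2 * d * (c + s * k) := by simp [hY, pow_two]; ring
    have hYp : 0 < Y.re := by
      rw [hYr]
      have : (c + s * k) ^ 2 = c ^ 2 + 2 * s * (k * c) + s ^ 2 * k ^ 2 := by ring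
      rw [this, hk]
      have := mul_nonneg hs.le hkc
      nlinarith [sq_nonneg s]
    have hn : 0 < Complex.normSq Y := by
      apply Complex.normSq_pos.mpr
      intro h; rw [h] at hYp; simp at hYp
    have hxy : 0 ≤ X.im * Y.im := by
      have h4 : 0 ≤ X.re * (X.im * Y.im) := by
        have : X.re * (X.im * Y.im) = 2 * d ^ 2 * (k * c + s * k ^ 2) := by
          rw [hYi]; linear_combination (d * (c + s * k)) * h3
        rw [this, hk]
        have : 0 ≤ k * c + s * 1 := by linarith
        positivity
      exact nonneg_of_mul_nonneg_right h4 h1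
    have h5 : 0 < X.re * Y.re / Complex.normSq Y := by positivity
    have h6 : 0 ≤ X.im * Y.im / Complex.normSq Y := by positivity
    linarith

/-! ### Parameters -/

lemma params (A B : ℝ) (hA : -1 < A) (hB : -1 < B) (hAB1 : A + B < -1) :
    ∃ c d a b s1 s2 : ℝ, Par c d a b ∧ zetaP A B = c + d * I ∧ zetaM A B = c - d * I ∧
      0 < s1 ∧ 0 < s2 ∧ s1 ^ 2 = (1 - c) ^ 2 + d ^ 2 ∧ s2 ^ 2 = (-1 - c) ^ 2 + d ^ 2 ∧
      a = (1 - c + s1) / d ∧ b = (-1 - c - s2) / d := by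
  have hn : (A + B + 2) ≠ 0 := by linarith
  have hprod : 0 < (A + 1) * (B + 1) * (-A - B - 1) :=
    mul_pos (mul_pos (by linarith) (by linarith)) (by linarith)
  set r := Real.sqrt ((A + 1) * (B + 1) * (-A - B - 1)) with hr
  have hr0 : 0 < r := Real.sqrt_pos.mpr hprod
  obtain ⟨c, hc⟩ : ∃ c : ℝ, c = (B ^ 2 - A ^ 2) / (A + B + 2) ^ 2 := ⟨_, rfl⟩
  obtain ⟨d, hd⟩ : ∃ d : ℝ, d = 4 * r / (A + B + 2) ^ 2 := ⟨_, rfl⟩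
  have hd0 : 0 < d := by rw [hd]; positivity
  have hP : zetaP A B = c + d * I := by
    unfold zetaP; rw [← hr, hc, hd]; push_cast; ring
  have hM : zetaM A B = c - d * I := by
    unfold zetaM; rw [← hr, hc, hd]; push_cast; ring
  clear_value r
  obtain ⟨s1, hs1, h1⟩ : ∃ s : ℝ, 0 < s ∧ s ^ 2 = (1 - c) ^ 2 + d ^ 2 :=
    ⟨Real.sqrt ((1 - c) ^ 2 + d ^ 2), Real.sqrt_pos.mpr (by positivity),
      Real.sq_sqrt (by positivity)⟩
  obtain ⟨s2, hs2, h2⟩ : ∃ s : ℝ, 0 < s ∧ s ^ 2 = (-1 - c) ^ 2 + d ^ 2 :=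
    ⟨Real.sqrt ((-1 - c) ^ 2 + d ^ 2), Real.sqrt_pos.mpr (by positivity),
      Real.sq_sqrt (by positivity)⟩
  have hdd : 0 < d ^ 2 := by positivity
  have g1 : 0 < 1 - c + s1 := by nlinarith
  have g2 : 0 < s2 - (-1 - c) := by nlinarith
  have g3 : 0 < s2 + (-1 - c) := by nlinarith
  have g4 : s2 < s1 + 2 := by nlinarith
  refine ⟨c, d, _, _, s1, s2, ⟨hd0, div_pos g1 hd0, div_neg_of_neg_of_pos (by linarith) hd0,
    ?_, ?_, ?_⟩, hP, hM, hs1, hs2, h1, h2, rfl, rfl⟩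
  · rw [div_mul_div_comm, div_lt_iff₀ (by positivity)]
    have : d * d = (s2 + (-1 - c)) * (s2 - (-1 - c)) := by linear_combination -h2
    rw [this]
    have := mul_pos (show 0 < (1 - c + s1) - (s2 + (-1 - c)) by linarith) g2
    linarith
  · field_simp; linear_combination h1
  · field_simp; linear_combination h2

structure Ctx (A B c d a b s1 s2 : ℝ) (ΓC : Set ℂ) (R : ℂ → ℂ) : Prop where
  P : Par c d a b
  hP : zetaP A B = c + d * I
  hM : zetaM A B = c - d * I
  s1p : 0 < s1
  s2p : 0 < s2
  s1e : s1 ^ 2 = (1 - c) ^ 2 + d ^ 2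
  s2e : s2 ^ 2 = (-1 - c) ^ 2 + d ^ 2
  ae : a = (1 - c + s1) / d
  be : b = (-1 - c - s2) / d
  arc : IsCenterArc A B ΓC
  br : IsSqrtBranch A B ΓC R

def Wf (c d : ℝ) (R : ℂ → ℂ) (z : ℂ) : ℂ := (z - c + R z) / d

section ctx
variable {A B c d a b s1 s2 : ℝ} {ΓC : Set ℂ} {R : ℂ → ℂ}

lemma Ctx.op (X : Ctx A B c d a b s1 s2 ΓC R) : IsOpen ΓCᶜ :=
  X.arc.1.isClosed.isOpen_compl

lemma Ctx.sqe (X : Ctx A B c d a b s1 s2 ΓC R) (z : ℂ) (hz : z ∉ ΓC) :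
    R z ^ 2 = (z - c) ^ 2 + d ^ 2 := by
  rw [X.br.2.1 z hz, X.hP, X.hM]
  linear_combination -(d:ℂ) ^ 2 * Complex.I_mul_I

lemma Ctx.spec (X : Ctx A B c d a b s1 s2 ΓC R) (z : ℂ) (hz : z ∉ ΓC) :
    Wf c d R z ≠ 0 ∧ zf c d (Wf c d R z) = z :=
  let h := w_spec c d X.P.d0.ne' z (R z) (X.sqe z hz)
  ⟨h.1, h.2.1⟩

lemma Ctx.Rdiff (X : Ctx A B c d a b s1 s2 ΓC R) (z : ℂ) (hz : z ∉ ΓC) :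
    DifferentiableAt ℂ R z :=
  X.br.1.differentiableAt (X.op.mem_nhds hz)

lemma Ctx.Wdiff (X : Ctx A B c d a b s1 s2 ΓC R) (z : ℂ) (hz : z ∉ ΓC) :
    DifferentiableAt ℂ (Wf c d R) z := by
  have := X.Rdiff z hz
  unfold Wf
  fun_prop

lemma Ctx.R_end (X : Ctx A B c d a b s1 s2 ΓC R) (e s : ℝ) (he : e ^ 2 = 1) (hs : 0 < s)
    (hse : s ^ 2 = (e - c) ^ 2 + d ^ 2) : (e : ℂ) ∉ ΓC ∧ R e = e * s := by
  have hd0 := X.P.d0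
  have he0 : e ≠ 0 := by rintro rfl; norm_num at he
  have hout : ∀ x : ℝ, 1 ≤ x → ((e * x : ℝ) : ℂ) ∉ ΓC := by
    intro x hx hmem
    have := X.arc.2.2.2.2.2 _ hmem (by simp)
    simp only [Complex.ofReal_re] at this
    have h2 : (e * x) ^ 2 < 1 := by nlinarith
    have h3 : (e * x) ^ 2 = x ^ 2 := by rw [mul_pow, he, one_mul]
    nlinarith
  set f : ℝ → ℝ := fun x => e * (R ((e * x : ℝ) : ℂ)).re with hf
  have hfc : ContinuousOn f (Ici 1) := by
    intro x hx
    apply ContinuousAt.continuousWithinAt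
    have h1 := (X.Rdiff _ (hout x hx)).continuousAt
    have h2 : ContinuousAt (fun x : ℝ => R ((e * x : ℝ) : ℂ)) x :=
      ContinuousAt.comp (f := fun x : ℝ => ((e * x : ℝ) : ℂ)) h1 (by fun_prop)
    exact continuousAt_const.mul (Complex.continuous_re.continuousAt.comp h2)
  have hfne : ∀ x : ℝ, 1 ≤ x → f x ≠ 0 := by
    intro x hx h0
    have h1 : (R ((e * x : ℝ) : ℂ)).re = 0 := by
      rcases mul_eq_zero.mp h0 with h | h
      · exact absurd h he0
      · exact h
    have h2 := congrArg Complex.re (X.sqe _ (hout x hx))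
    have h3 : (((e * x : ℝ) : ℂ) - c) ^ 2 + (d:ℂ) ^ 2 = (((e * x - c) ^ 2 + d ^ 2 : ℝ) : ℂ) := by
      push_cast; ring
    rw [h3, Complex.ofReal_re, pow_two, Complex.mul_re, h1] at h2
    nlinarith [sq_nonneg (e * x - c), mul_self_nonneg (R ((e * x : ℝ) : ℂ)).im, pow_pos hd0 2]
  have hlarge : ∃ x : ℝ, 1 ≤ x ∧ 0 < f x := by
    have ht : Tendsto (fun x : ℝ => ((e * x : ℝ) : ℂ)) atTop (cobounded ℂ) := by
      rw [← tendsto_norm_atTop_iff_cobounded]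
      have he1 : |e| = 1 := by
        rw [← sq_abs] at he
        nlinarith [abs_nonneg e]
      have : (fun x : ℝ => ‖((e * x : ℝ) : ℂ)‖) = fun x => |x| := by
        ext x; rw [Complex.norm_real, Real.norm_eq_abs, abs_mul, he1, one_mul]
      rw [this]; exact tendsto_abs_atTop_atTop
    have h1 := X.br.2.2.comp ht
    have h2 := (Complex.continuous_re.tendsto 1).comp h1
    have h3 := h2.eventually (lt_mem_nhds (show (0:ℝ) < (1:ℂ).re by simp))
    obtain ⟨x, hx1, hx⟩ := (h3.and (eventually_ge_atTop 1)).exists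
    refine ⟨x, hx, ?_⟩
    simp only [Function.comp] at hx1
    rw [Complex.div_ofReal_re] at hx1
    have hx0 : 0 < x := by linarith
    have e1 : f x = x * ((R ((e * x : ℝ) : ℂ)).re / (e * x)) := by
      simp only [hf]; field_simp; rw [he, one_mul]
    rw [e1]; positivity
  obtain ⟨x, hx, hfx⟩ := hlarge
  have hf1 : 0 < f 1 := by
    by_contra hcon
    push Not at hcon
    obtain ⟨y, hy, hy0⟩ := isPreconnected_Ici.intermediate_value (a := 1) (b := x) (by simp) hx hfc
      ⟨hcon, hfx.le⟩
    exact hfne y hy hy0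
  have hout1 : (e : ℂ) ∉ ΓC := by simpa using hout 1 le_rfl
  refine ⟨hout1, ?_⟩
  have hq := X.sqe _ hout1
  have hq2 : (R e - s) * (R e + s) = 0 := by
    have : (s:ℂ) ^ 2 = (e - c) ^ 2 + d ^ 2 := by exact_mod_cast hse
    linear_combination hq - this
  have hf1' : 0 < e * (R e).re := by simpa [hf] using hf1
  have hee : e = 1 ∨ e = -1 := by
    have : (e - 1) * (e + 1) = 0 := by linear_combination he
    rcases mul_eq_zero.mp this with h | h
    · left; linarith
    · right; linarith
  rcases mul_eq_zero.mp hq2 with h | h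
  · have h' : R e = s := by linear_combination h
    rcases hee with rfl | rfl
    · rw [h']; simp
    · exfalso; rw [h'] at hf1'; simp at hf1'; linarith
  · have h' : R e = -s := by linear_combination h
    rcases hee with rfl | rfl
    · exfalso; rw [h'] at hf1'; simp at hf1'; linarith
    · rw [h']; simp

lemma Ctx.one (X : Ctx A B c d a b s1 s2 ΓC R) :
    (1 : ℂ) ∉ ΓC ∧ R 1 = s1 ∧ Wf c d R 1 = a := by
  have h := X.R_end 1 s1 (by norm_num) X.s1p X.s1e
  simp only [Complex.ofReal_one, one_mul] at h
  refine ⟨h.1, h.2, ?_⟩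
  unfold Wf; rw [h.2, X.ae]; push_cast; ring

lemma Ctx.mone (X : Ctx A B c d a b s1 s2 ΓC R) :
    (-1 : ℂ) ∉ ΓC ∧ R (-1) = -s2 ∧ Wf c d R (-1) = b := by
  have h := X.R_end (-1) s2 (by norm_num) X.s2p X.s2e
  simp only [Complex.ofReal_one, Complex.ofReal_neg, neg_mul, one_mul] at h
  refine ⟨h.1, h.2, ?_⟩
  unfold Wf; rw [h.2, X.be]; push_cast; ring

lemma Ctx.Np (X : Ctx A B c d a b s1 s2 ΓC R) (z : ℂ) (hz : z ∉ ΓC) (h1 : z ≠ 1) (h2 : z ≠ -1) :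
    Np a b (Wf c d R z) := by
  obtain ⟨h3, h4⟩ := X.spec z hz
  rw [Np_iff X.P _ h3, h4]
  exact ⟨h1, h2⟩

lemma Ctx.integral (X : Ctx A B c d a b s1 s2 ΓC R) (z : ℂ) (γ : ℝ → ℂ)
    (hγ : AdmissiblePath A B ΓC z γ) :
    (∫ t in (0:ℝ)..1, R (γ t) / ((γ t) ^ 2 - 1) * deriv γ t).re = Hf a b (Wf c d R z) := by
  obtain ⟨hc, h0, h1, hall⟩ := hγ
  rw [X.hM] at h0
  set g : ℝ → ℂ := fun t => if t ≤ 0 then 0 else R (γ t) with hg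
  have hd0 := X.P.d0
  have hg' : ∀ t, 0 < t → g t = R (γ t) := fun t ht => by simp [hg, not_le.mpr ht]
  have hsq : ∀ t ∈ Icc (0:ℝ) 1, g t ^ 2 = (γ t - c) ^ 2 + d ^ 2 := by
    intro t ht
    rcases ht.1.eq_or_lt with h | h
    · subst h
      simp only [hg, le_refl, if_true]
      rw [h0]; linear_combination -(d:ℂ) ^ 2 * Complex.I_mul_I
    · rw [hg' t h, X.sqe _ (hall t ⟨h, ht.2⟩).1]
  have hne : ∀ t ∈ Icc (0:ℝ) 1, γ t ≠ 1 ∧ γ t ≠ -1 := by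
    intro t ht
    rcases ht.1.eq_or_lt with h | h
    · subst h
      rw [h0]
      constructor
      · intro h; have := congrArg Complex.im h; simp at this; linarith
      · intro h; have := congrArg Complex.im h; simp at this; linarith
    · exact (hall t ⟨h, ht.2⟩).2
  have hgc : ContinuousOn g (Icc 0 1) := by
    intro t ht
    rcases ht.1.eq_or_lt with h | h
    · subst h
      have hg0 : g 0 = 0 := by simp [hg]
      unfold ContinuousWithinAt
      rw [hg0]
      have hb : Tendsto (fun t => Real.sqrt ‖(γ t - c) ^ 2 + (d:ℂ) ^ 2‖) (𝓝[Icc 0 1] 0) (𝓝 0) := by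
        have hcc : Continuous γ := hc.continuous
        have : Continuous (fun t => Real.sqrt ‖(γ t - c) ^ 2 + (d:ℂ) ^ 2‖) := by fun_prop
        have h2 := this.continuousWithinAt (s := Icc (0:ℝ) 1) (x := 0)
        unfold ContinuousWithinAt at h2
        simp only [← hsq 0 ht, hg0] at h2
        simpa using h2
      apply squeeze_zero_norm' _ hb
      filter_upwards [self_mem_nhdsWithin] with t ht
      rw [← hsq t ht, norm_pow, Real.sqrt_sq (norm_nonneg _)]
    · apply ContinuousAt.continuousWithinAt
      have h2 : ContinuousAt (fun t => R (γ t)) t :=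
        ContinuousAt.comp (X.Rdiff _ (hall t ⟨h, ht.2⟩).1).continuousAt hc.continuous.continuousAt
      apply h2.congr
      filter_upwards [lt_mem_nhds h] with s hs
      exact (hg' s hs).symm
  have key := ftc X.P γ g hc h0 hne hgc hsq
  have e : (∫ t in (0:ℝ)..1, R (γ t) / ((γ t) ^ 2 - 1) * deriv γ t) =
      ∫ t in (0:ℝ)..1, g t / ((γ t) ^ 2 - 1) * deriv γ t := by
    apply intervalIntegral.integral_congr_ae
    filter_upwards with t ht
    rw [uIoc_of_le zero_le_one] at ht
    rw [hg' t ht.1]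
  rw [e, key, hg' 1 one_pos, h1]
  rfl

lemma Ctx.path (X : Ctx A B c d a b s1 s2 ΓC R) (z : ℂ) (hz : z ∉ ΓC) (h1 : z ≠ 1) (h2 : z ≠ -1) :
    ∃ γ, AdmissiblePath A B ΓC z γ := by
  have hconn := compl_conn X.P X.hP X.hM ΓC X.arc
  have o1 : IsOpen (ΓCᶜ \ {(1:ℂ)}) := X.op.sdiff isClosed_singleton
  have o2 : IsOpen ((ΓCᶜ \ {(1:ℂ)}) \ {(-1:ℂ)}) := o1.sdiff isClosed_singleton
  have c1 := aux_diff_point _ X.op hconn 1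
  have c2 := aux_diff_point _ o1 c1 (-1)
  obtain ⟨γ₀, g0, g1, g2⟩ := start_path X.P X.hP X.hM
  obtain ⟨γ, k1, k2, k3, k4⟩ := aux_reach _ o2 c2 (c - d * I) γ₀ g0 g1
    (fun t ht => ⟨⟨fun h => (g2 t ht).1 (X.arc.2.2.2.2.1 h), (g2 t ht).2.1⟩, (g2 t ht).2.2⟩)
    z ⟨⟨hz, h1⟩, h2⟩
  exact ⟨γ, k1, by rw [X.hM, k2], k3, fun t ht => ⟨(k4 t ht).1.1, (k4 t ht).1.2, (k4 t ht).2⟩⟩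

end ctx
/-! ### Signs -/

def Ef (a b : ℝ) (w : ℂ) : ℝ :=
  ‖w‖ * ((‖w - a‖ / ‖a * w + 1‖) ^ pf a b * (‖w - b‖ / ‖b * w + 1‖) ^ qf a b)

lemma Ef_exp (a b : ℝ) (w : ℂ) (h : Np a b w) : Ef a b w = Real.exp (Hf a b w) := by
  obtain ⟨h0, h1, h2, h3, h4⟩ := h
  have k0 := norm_pos_iff.mpr h0
  have k1 := norm_pos_iff.mpr h1
  have k2 := norm_pos_iff.mpr h2
  have k3 := norm_pos_iff.mpr h3
  have k4 := norm_pos_iff.mpr h4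
  unfold Ef Hf
  rw [Real.exp_add, Real.exp_add, Real.exp_log k0, Real.rpow_def_of_pos (div_pos k1 k2),
    Real.rpow_def_of_pos (div_pos k3 k4), Real.log_div k1.ne' k2.ne', Real.log_div k3.ne' k4.ne',
    mul_comm (pf a b), mul_comm (qf a b)]

lemma quot_lim (a : ℝ) (ha : a ≠ 0) :
    Tendsto (fun w : ℂ => ‖w - a‖ / ‖a * w + 1‖) (cobounded ℂ) (𝓝 |a|⁻¹) := by
  have ha' : (a:ℂ) ≠ 0 := by exact_mod_cast ha
  have hi : Tendsto (fun w : ℂ => w⁻¹) (cobounded ℂ) (𝓝 0) := tendsto_inv₀_cobounded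
  have h1 : Tendsto (fun w : ℂ => ‖1 - a * w⁻¹‖ / ‖a + w⁻¹‖) (cobounded ℂ) (𝓝 |a|⁻¹) := by
    have n1 : Tendsto (fun w : ℂ => ‖1 - a * w⁻¹‖) (cobounded ℂ) (𝓝 1) := by
      have := (tendsto_const_nhds (x := (1:ℂ)).sub (hi.const_mul (a:ℂ))).norm
      simpa using this
    have n2 : Tendsto (fun w : ℂ => ‖a + w⁻¹‖) (cobounded ℂ) (𝓝 |a|) := by
      have := (tendsto_const_nhds (x := (a:ℂ)).add hi).norm
      simpa using this
    have := n1.div n2 (abs_pos.mpr ha).ne'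
    rwa [one_div] at this
  apply h1.congr'
  have hne : ∀ᶠ w : ℂ in cobounded ℂ, w ≠ 0 := eventually_ne_cobounded 0
  filter_upwards [hne] with w hw
  have e1 : w - a = w * (1 - a * w⁻¹) := by field_simp
  have e2 : a * w + 1 = w * (a + w⁻¹) := by field_simp
  rw [e1, e2, norm_mul, norm_mul, mul_div_mul_left _ _ (norm_ne_zero_iff.mpr hw)]

lemma Ef_lim {c d a b : ℝ} (P : Par c d a b) : Tendsto (Ef a b) (cobounded ℂ) atTop := by
  have ha := P.a0.ne'
  have hb := P.b0.ne
  have h1 := (quot_lim a ha).rpow_const (p := pf a b) (Or.inr P.p0.le)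
  have h2 := (quot_lim b hb).rpow_const (p := qf a b) (Or.inr P.q0.le)
  have h3 := h1.mul h2
  refine Tendsto.atTop_mul_pos ?_ tendsto_norm_cobounded_atTop h3
  have := abs_pos.mpr ha
  have := abs_pos.mpr hb
  positivity

section ctx
variable {A B c d a b s1 s2 : ℝ} {ΓC : Set ℂ} {R : ℂ → ℂ}

lemma Ctx.E_cont (X : Ctx A B c d a b s1 s2 ΓC R) :
    ContinuousOn (fun z => Ef a b (Wf c d R z)) ΓCᶜ := by
  intro z hz
  apply ContinuousAt.continuousWithinAt
  have hW := (X.Wdiff z hz).continuousAt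
  have hab := X.P.ab
  have ha0 := X.P.a0
  have hb0 := X.P.b0
  have hne : a * Wf c d R z + 1 ≠ 0 ∧ b * Wf c d R z + 1 ≠ 0 := by
    by_cases h1 : z = 1
    · rw [h1, X.one.2.2]
      constructor
      · intro h
        have : a * a + 1 = 0 := by exact_mod_cast h
        nlinarith
      · intro h
        have : b * a + 1 = 0 := by exact_mod_cast h
        nlinarith
    by_cases h2 : z = -1
    · rw [h2, X.mone.2.2]
      constructor
      · intro h
        have : a * b + 1 = 0 := by exact_mod_cast h
        nlinarith
      · intro h
        have : b * b + 1 = 0 := by exact_mod_cast h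
        nlinarith
    · have := X.Np z hz h1 h2
      exact ⟨this.2.2.1, this.2.2.2.2⟩
  unfold Ef
  have q (x p : ℝ) (hp : 0 < p) (hx : x * Wf c d R z + 1 ≠ 0) :
      ContinuousAt (fun z => (‖Wf c d R z - x‖ / ‖x * Wf c d R z + 1‖) ^ p) z := by
    apply ContinuousAt.rpow_const _ (Or.inr hp.le)
    exact (hW.sub continuousAt_const).norm.div
      ((continuousAt_const.mul hW).add continuousAt_const).norm (norm_ne_zero_iff.mpr hx)
  exact hW.norm.mul ((q a _ X.P.p0 hne.1).mul (q b _ X.P.q0 hne.2))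

lemma Ctx.E_one (X : Ctx A B c d a b s1 s2 ΓC R) : Ef a b (Wf c d R 1) = 0 := by
  rw [X.one.2.2]; unfold Ef
  rw [sub_self, norm_zero, zero_div, Real.zero_rpow X.P.p0.ne']; simp

lemma Ctx.E_mone (X : Ctx A B c d a b s1 s2 ΓC R) : Ef a b (Wf c d R (-1)) = 0 := by
  rw [X.mone.2.2]; unfold Ef
  rw [sub_self, norm_zero, zero_div, Real.zero_rpow X.P.q0.ne']; simp

lemma Ctx.E_ne (X : Ctx A B c d a b s1 s2 ΓC R) (z : ℂ) (hz : z ∉ GammaSet A B) :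
    Ef a b (Wf c d R z) ≠ 1 := by
  intro hE
  have hzC : z ∉ ΓC := fun h => hz (X.arc.2.2.2.2.1 h)
  by_cases h1 : z = 1
  · rw [h1, X.E_one] at hE; norm_num at hE
  by_cases h2 : z = -1
  · rw [h2, X.E_mone] at hE; norm_num at hE
  have hN := X.Np z hzC h1 h2
  rw [Ef_exp _ _ _ hN, Real.exp_eq_one_iff] at hE
  have := H_gamma X.P X.hP X.hM _ hN hE
  rw [(X.spec z hzC).2] at this
  exact hz this

lemma Ctx.E_side (X : Ctx A B c d a b s1 s2 ΓC R) (C : Set ℂ) (hC : IsPreconnected C)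
    (hsub : C ⊆ (GammaSet A B)ᶜ) (x y : ℂ) (hx : x ∈ C) (hy : y ∈ C)
    (h : Ef a b (Wf c d R x) < 1) : Ef a b (Wf c d R y) < 1 := by
  by_contra hcon
  push Not at hcon
  have hCc : C ⊆ ΓCᶜ := fun z hz h => hsub hz (X.arc.2.2.2.2.1 h)
  obtain ⟨t, ht, ht1⟩ := hC.intermediate_value hx hy (X.E_cont.mono hCc) ⟨h.le, hcon⟩
  exact X.E_ne t (hsub ht) ht1

lemma Ctx.W_lim (X : Ctx A B c d a b s1 s2 ΓC R) :
    Tendsto (Wf c d R) (cobounded ℂ) (cobounded ℂ) := by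
  have hd := X.P.d0
  have hdc : (d:ℂ) ≠ 0 := by exact_mod_cast hd.ne'
  rw [← tendsto_norm_atTop_iff_cobounded]
  have hi : Tendsto (fun w : ℂ => w⁻¹) (cobounded ℂ) (𝓝 0) := tendsto_inv₀_cobounded
  have h1 : Tendsto (fun z : ℂ => ‖(1 - c * z⁻¹ + R z / z) / d‖) (cobounded ℂ)
      (𝓝 ‖((1 - c * 0 + 1) / d : ℂ)‖) :=
    (((tendsto_const_nhds.sub (hi.const_mul (c:ℂ))).add X.br.2.2).div_const (d:ℂ)).norm
  have h2 : Tendsto (fun z : ℂ => ‖z‖ * ‖(1 - c * z⁻¹ + R z / z) / d‖) (cobounded ℂ) atTop := by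
    refine Tendsto.atTop_mul_pos ?_ tendsto_norm_cobounded_atTop h1
    apply norm_pos_iff.mpr
    apply div_ne_zero _ hdc
    norm_num
  apply h2.congr'
  have hne : ∀ᶠ w : ℂ in cobounded ℂ, w ≠ 0 := eventually_ne_cobounded 0
  filter_upwards [hne] with z hz
  rw [← norm_mul]
  congr 1
  unfold Wf
  field_simp

lemma Ctx.E_unb (X : Ctx A B c d a b s1 s2 ΓC R) (C : Set ℂ) (hC : ¬ IsBounded C) :
    ∃ z ∈ C, 1 < Ef a b (Wf c d R z) := by
  by_contra hcon
  push Not at hcon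
  apply hC
  have h := ((Ef_lim X.P).comp X.W_lim).eventually_gt_atTop 1
  have h2 : IsBounded ({z | 1 < (Ef a b ∘ Wf c d R) z}ᶜ) := isBounded_compl_iff.mpr h
  apply h2.subset
  intro z hz hz2
  have : 1 < Ef a b (Wf c d R z) := hz2
  linarith [hcon z hz]

lemma Ctx.E_pos (X : Ctx A B c d a b s1 s2 ΓC R) (C : Set ℂ) (hC : IsPreconnected C)
    (hsub : C ⊆ (GammaSet A B)ᶜ) (hu : ¬ IsBounded C) (x : ℂ) (hx : x ∈ C) :
    1 < Ef a b (Wf c d R x) := by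
  obtain ⟨y, hy, hy1⟩ := X.E_unb C hu
  by_contra hcon
  push Not at hcon
  have := X.E_side C hC hsub x y hx hy (lt_of_le_of_ne hcon (X.E_ne x (hsub hx)))
  linarith

lemma ray_unbounded (z₀ u : ℂ) (hu : ‖u‖ = 1) :
    ¬ IsBounded ((fun s : ℝ => z₀ + s * u) '' Ioi 0) := by
  intro hb
  obtain ⟨M, hM⟩ := hb.exists_norm_le
  have hM0 : 0 ≤ M := (norm_nonneg _).trans (hM _ ⟨1, by simp, rfl⟩)
  have h := hM _ ⟨M + ‖z₀‖ + 1, by simp only [mem_Ioi]; positivity, rfl⟩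
  have h2 : ‖((M + ‖z₀‖ + 1 : ℝ) : ℂ) * u‖ = M + ‖z₀‖ + 1 := by
    rw [norm_mul, hu, mul_one, Complex.norm_real, Real.norm_eq_abs, abs_of_nonneg (by positivity)]
  have h3 : ‖((M + ‖z₀‖ + 1 : ℝ) : ℂ) * u‖ ≤
      ‖z₀ + ((M + ‖z₀‖ + 1 : ℝ) : ℂ) * u‖ + ‖z₀‖ := by
    have := norm_sub_le (z₀ + ((M + ‖z₀‖ + 1 : ℝ) : ℂ) * u) z₀
    rwa [add_sub_cancel_left] at this
  simp only at h
  linarith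

/-- a component on which `E < 1` somewhere does not meet a ray in `ℂ∖Γ`. -/
lemma Ctx.no_ray (X : Ctx A B c d a b s1 s2 ΓC R) (x z₀ u : ℂ) (hu : ‖u‖ = 1)
    (hr : ∀ s : ℝ, 0 < s → z₀ + s * u ∉ GammaSet A B)
    (hx : x ∈ (GammaSet A B)ᶜ) (hE : Ef a b (Wf c d R x) < 1) (s : ℝ) (hs : 0 < s) :
    z₀ + s * u ∉ connectedComponentIn (GammaSet A B)ᶜ x := by
  intro hmem
  set L := (fun s : ℝ => z₀ + s * u) '' Ioi 0 with hL
  have hLc : IsPreconnected L := isPreconnected_Ioi.image _ (by fun_prop)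
  have hLs : L ⊆ (GammaSet A B)ᶜ := by
    rintro _ ⟨s, hs, rfl⟩; exact hr s hs
  have h1 : L ⊆ connectedComponentIn (GammaSet A B)ᶜ (z₀ + s * u) :=
    hLc.subset_connectedComponentIn ⟨s, hs, rfl⟩ hLs
  rw [← connectedComponentIn_eq hmem] at h1
  have h2 := X.E_pos _ isPreconnected_connectedComponentIn (connectedComponentIn_subset _ _)
    (fun hb => ray_unbounded z₀ u hu (hb.subset h1)) x (mem_connectedComponentIn hx)
  linarith

lemma not_slit (y : ℂ) (h : y ∉ slitPlane) : ∃ s : ℝ, 0 ≤ s ∧ y = -s := by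
  rw [Complex.mem_slitPlane_iff, not_or] at h
  push Not at h
  refine ⟨-y.re, by linarith [h.1], ?_⟩
  apply Complex.ext
  · simp
  · simp [h.2]

lemma one_notin (A B : ℝ) : (1:ℂ) ∈ (GammaSet A B)ᶜ := by
  rintro ⟨γ, g, -, -, h1, hne, -⟩
  exact (hne 1 (by simp)).1 h1

lemma mone_notin (A B : ℝ) : (-1:ℂ) ∈ (GammaSet A B)ᶜ := by
  rintro ⟨γ, g, -, -, h1, hne, -⟩
  exact (hne 1 (by simp)).2 h1

/-- `1` and `-1` lie in different components. -/
lemma Ctx.sep (X : Ctx A B c d a b s1 s2 ΓC R) :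
    (-1 : ℂ) ∉ connectedComponentIn (GammaSet A B)ᶜ (1:ℂ) := by
  intro hmem
  set C := connectedComponentIn (GammaSet A B)ᶜ (1:ℂ) with hCdef
  have hCsub : C ⊆ (GammaSet A B)ᶜ := connectedComponentIn_subset _ _
  have hCc : C ⊆ ΓCᶜ := fun z hz h => hCsub hz (X.arc.2.2.2.2.1 h)
  have h1C : (1:ℂ) ∈ C := mem_connectedComponentIn (one_notin A B)
  have hE1 : Ef a b (Wf c d R 1) < 1 := by rw [X.E_one]; norm_num
  obtain ⟨u, hu, -, hray⟩ := exists_ray X.P X.hP X.hM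
  have hun : ‖u‖ = 1 := by
    rw [Complex.mul_conj, Complex.normSq_eq_norm_sq] at hu
    have : ‖u‖ ^ 2 = 1 := by exact_mod_cast hu
    nlinarith [norm_nonneg u]
  have hzP : (c + d * I : ℂ) ∉ C := fun h => hCc h (X.hP ▸ X.arc.2.2.1)
  have hzM : (c - d * I : ℂ) ∉ C := fun h => hCc h (X.hM ▸ X.arc.2.2.2.1)
  have hcj : ∀ s : ℝ, (starRingEnd ℂ) (c + d * I + s * u : ℂ) =
      (c - d * I) + s * (starRingEnd ℂ) u := by
    intro s; simp; ring
  have hr1 : ∀ s : ℝ, 0 < s → (c + d * I + s * u : ℂ) ∉ C := fun s hs =>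
    X.no_ray 1 _ u hun (fun s hs => (hray s hs).1) (one_notin A B) hE1 s hs
  have hr2 : ∀ s : ℝ, 0 < s → ((c - d * I) + s * (starRingEnd ℂ) u : ℂ) ∉ C := fun s hs =>
    X.no_ray 1 _ _ (by rw [Complex.norm_conj, hun])
      (fun s hs => by rw [← hcj]; exact (hray s hs).2) (one_notin A B) hE1 s hs
  have hs1 : ∀ z ∈ C, ((c + d * I) - z) * (starRingEnd ℂ) u ∈ slitPlane := by
    intro z hz
    by_contra hn
    obtain ⟨s, hs, he⟩ := not_slit _ hn
    have hz' : z = c + d * I + s * u := by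
      linear_combination (-u) * he + (z - (c + d * I)) * (-hu) 
    rcases hs.eq_or_lt with h | h
    · rw [← h] at hz'; simp at hz'; exact hzP (hz' ▸ hz)
    · exact hr1 s h (hz' ▸ hz)
  have hs2 : ∀ z ∈ C, ((c - d * I) - z) * u ∈ slitPlane := by
    intro z hz
    by_contra hn
    obtain ⟨s, hs, he⟩ := not_slit _ hn
    have hz' : z = c - d * I + s * (starRingEnd ℂ) u := by
      linear_combination (-(starRingEnd ℂ) u) * he + (z - (c - d * I)) * (-hu) 
    rcases hs.eq_or_lt with h | h
    · rw [← h] at hz'; simp at hz'; exact hzM (hz' ▸ hz)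
    · exact hr2 s h (hz' ▸ hz)
  set S : ℂ → ℂ := fun z => csq (((c + d * I) - z) * (starRingEnd ℂ) u) *
    csq (((c - d * I) - z) * u) with hS
  have hSsq : ∀ z ∈ C, S z ^ 2 = R z ^ 2 := by
    intro z hz
    rw [X.sqe z (hCc hz)]
    simp only [hS]
    rw [mul_pow, csq_sq _ (slitPlane_ne_zero (hs1 z hz)), csq_sq _ (slitPlane_ne_zero (hs2 z hz))]
    linear_combination ((c + d * I - z) * (c - d * I - z)) * hu - (d:ℂ) ^ 2 * Complex.I_mul_I
  have hS0 : ∀ z ∈ C, S z ≠ 0 := by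
    intro z hz
    exact mul_ne_zero (Complex.exp_ne_zero _) (Complex.exp_ne_zero _)
  have hSc : ContinuousOn S C := by
    intro z hz
    apply ContinuousAt.continuousWithinAt
    apply ContinuousAt.mul
    · exact ContinuousAt.comp (g := csq) (f := fun z : ℂ => ((c + d * I) - z) * (starRingEnd ℂ) u)
        (csq_cont _ (hs1 z hz)) (by fun_prop)
    · exact ContinuousAt.comp (g := csq) (f := fun z : ℂ => ((c - d * I) - z) * u)
        (csq_cont _ (hs2 z hz)) (by fun_prop)
  have hRc : ContinuousOn R C := fun z hz => (X.Rdiff z (hCc hz)).continuousAt.continuousWithinAt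
  have hT : ContinuousOn (fun z => (R z / S z).re) C :=
    Complex.continuous_re.comp_continuousOn (hRc.div hSc hS0)
  have hreal : ∀ e : ℝ, (e:ℂ) ∈ C → ∃ n : ℝ, 0 < n ∧ S e = n := by
    intro e he
    refine ⟨Complex.normSq (csq (((c + d * I) - (e:ℂ)) * (starRingEnd ℂ) u)),
      Complex.normSq_pos.mpr (Complex.exp_ne_zero _), ?_⟩
    have e1 : ((c - d * I) - (e:ℂ)) * u =
        (starRingEnd ℂ) (((c + d * I) - (e:ℂ)) * (starRingEnd ℂ) u) := by
      simp only [map_mul, map_sub, map_add, Complex.conj_ofReal, Complex.conj_I, Complex.conj_conj]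
      ring
    simp only [hS]
    rw [e1, csq_conj _ (hs1 _ he), Complex.mul_conj]
  obtain ⟨n1, hn1, hSn1⟩ := hreal 1 (by simpa using h1C)
  obtain ⟨n2, hn2, hSn2⟩ := hreal (-1) (by simpa using hmem)
  have v1 : 0 ≤ (R 1 / S 1).re := by
    have e1 : S 1 = n1 := by simpa using hSn1
    rw [e1, X.one.2.1, ← Complex.ofReal_div, Complex.ofReal_re]
    exact (div_pos X.s1p hn1).le
  have v2 : (R (-1) / S (-1)).re ≤ 0 := by
    have e1 : S (-1) = n2 := by simpa using hSn2
    rw [e1, X.mone.2.1, ← Complex.ofReal_neg, ← Complex.ofReal_div, Complex.ofReal_re, neg_div]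
    linarith [div_pos X.s2p hn2]
  obtain ⟨t, ht, ht0⟩ := isPreconnected_connectedComponentIn.intermediate_value hmem h1C hT ⟨v2, v1⟩
  have hsq : (R t / S t) ^ 2 = 1 := by
    rw [div_pow, hSsq t ht, div_self]
    rw [← hSsq t ht]; exact pow_ne_zero 2 (hS0 t ht)
  have h5 := congrArg Complex.re hsq
  have ht0' : (R t / S t).re = 0 := ht0
  rw [pow_two, Complex.mul_re, ht0', Complex.one_re] at h5
  nlinarith [mul_self_nonneg (R t / S t).im]

end ctx

/-- the function `h(z) = Re ∫_{ζ₋}^z R(t)/(t²−1) dt` (path in `ℂ∖Γ_C`) is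
single-valued (path independent) and harmonic on `ℂ∖(Γ_C ∪ {−1,1})` (i.e. locally the
real part of a holomorphic function); it is `> 0` on the unbounded component `Ω_∞` of
`ℂ∖Γ`, and `< 0` on the two bounded components `Ω_{−1}`, `Ω_1` (minus `−1`, `1`). -/
theorem h_harmonic_and_signs
    (A B : ℝ) (hA : -1 < A) (hA0 : A < 0) (hB : -1 < B) (hB0 : B < 0)
    (hAB : -2 < A + B) (hAB1 : A + B < -1)
    (ΓC : Set ℂ) (hΓC : IsCenterArc A B ΓC)
    (R : ℂ → ℂ) (hR : IsSqrtBranch A B ΓC R)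
    (h : ℂ → ℝ)
    (hdef : ∀ z ∉ ΓC ∪ {(-1 : ℂ), 1}, ∀ γ : ℝ → ℂ, AdmissiblePath A B ΓC z γ →
      h z = (∫ t in (0:ℝ)..1, R (γ t) / ((γ t) ^ 2 - 1) * deriv γ t).re) :
    -- single-valuedness: the real part of the integral is path independent
    (∀ z ∉ ΓC ∪ {(-1 : ℂ), 1}, ∀ γ₁ γ₂ : ℝ → ℂ,
      AdmissiblePath A B ΓC z γ₁ → AdmissiblePath A B ΓC z γ₂ →
      (∫ t in (0:ℝ)..1, R (γ₁ t) / ((γ₁ t) ^ 2 - 1) * deriv γ₁ t).re =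
        (∫ t in (0:ℝ)..1, R (γ₂ t) / ((γ₂ t) ^ 2 - 1) * deriv γ₂ t).re) ∧
    -- harmonicity: locally the real part of a holomorphic function
    (∀ z ∉ ΓC ∪ {(-1 : ℂ), 1}, ∃ ε > (0:ℝ), ∃ F : ℂ → ℂ,
      DifferentiableOn ℂ F (Metric.ball z ε) ∧
      ∀ w ∈ Metric.ball z ε, h w = (F w).re) ∧
    -- positive on the unbounded component of `ℂ∖Γ`
    (∀ z ∉ GammaSet A B,
      ¬ IsBounded (connectedComponentIn (GammaSet A B)ᶜ z) → 0 < h z) ∧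
    -- negative on the bounded component containing `−1` (minus the point `−1`)
    (∀ z ∈ connectedComponentIn (GammaSet A B)ᶜ (-1 : ℂ), z ≠ -1 → h z < 0) ∧
    -- negative on the bounded component containing `1` (minus the point `1`)
    (∀ z ∈ connectedComponentIn (GammaSet A B)ᶜ (1 : ℂ), z ≠ 1 → h z < 0) := by
  obtain ⟨c, d, a, b, s1, s2, P, hP, hM, p1, p2, q1, q2, ea, eb⟩ := params A B hA hB hAB1
  have X : Ctx A B c d a b s1 s2 ΓC R := ⟨P, hP, hM, p1, p2, q1, q2, ea, eb, hΓC, hR⟩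
  have hh : ∀ z, z ∉ ΓC → z ≠ 1 → z ≠ -1 → h z = Hf a b (Wf c d R z) := by
    intro z hz h1 h2
    obtain ⟨γ, hγ⟩ := X.path z hz h1 h2
    rw [hdef z (by simp [hz, h1, h2]) γ hγ, X.integral z γ hγ]
  have hneg : ∀ C : Set ℂ, IsPreconnected C → C ⊆ (GammaSet A B)ᶜ → ∀ x ∈ C,
      Ef a b (Wf c d R x) = 0 → ∀ z ∈ C, z ≠ 1 → z ≠ -1 → h z < 0 := by
    intro C hC hsub x hx hE z hz h1 h2
    have hzC : z ∉ ΓC := fun h => hsub hz (hΓC.2.2.2.2.1 h)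
    have h3 := X.E_side C hC hsub x z hx hz (by rw [hE]; norm_num)
    rw [Ef_exp _ _ _ (X.Np z hzC h1 h2), Real.exp_lt_one_iff] at h3
    rw [hh z hzC h1 h2]; exact h3
  refine ⟨?_, ?_, ?_, ?_, ?_⟩
  · intro z _ γ₁ γ₂ h1 h2
    rw [X.integral z γ₁ h1, X.integral z γ₂ h2]
  · intro z hz
    simp only [mem_union, mem_insert_iff, mem_singleton_iff, not_or] at hz
    obtain ⟨hzC, hz2, hz1⟩ := hz
    have hN := X.Np z hzC hz1 hz2
    obtain ⟨F, hF⟩ := Hf_loc P _ hN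
    have hF' : ∀ᶠ y in 𝓝 z, HasDerivAt F (Kf a b (Wf c d R y)) (Wf c d R y) ∧
        Hf a b (Wf c d R y) = (F (Wf c d R y)).re :=
      (X.Wdiff z hzC).continuousAt.eventually
        (p := fun v => HasDerivAt F (Kf a b v) v ∧ Hf a b v = (F v).re) hF
    have hall := hF'.and ((X.op.eventually_mem hzC).and
      ((eventually_ne_nhds hz1).and (eventually_ne_nhds hz2)))
    obtain ⟨ε, hε, hb⟩ := Metric.eventually_nhds_iff_ball.mp hall
    refine ⟨ε, hε, fun y => F (Wf c d R y), ?_, ?_⟩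
    · intro y hy
      apply DifferentiableAt.differentiableWithinAt
      exact DifferentiableAt.comp y (hb y hy).1.1.differentiableAt (X.Wdiff y (hb y hy).2.1)
    · intro y hy
      obtain ⟨⟨-, k1⟩, k2, k3, k4⟩ := hb y hy
      rw [hh y k2 k3 k4, k1]
  · intro z hz hub
    have hzC : z ∉ ΓC := fun h => hz (hΓC.2.2.2.2.1 h)
    have hE := X.E_pos _ isPreconnected_connectedComponentIn (connectedComponentIn_subset _ _) hub z
      (mem_connectedComponentIn hz)
    have h1 : z ≠ 1 := by
      rintro rfl; rw [X.E_one] at hE; norm_num at hE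
    have h2 : z ≠ -1 := by
      rintro rfl; rw [X.E_mone] at hE; norm_num at hE
    rw [Ef_exp _ _ _ (X.Np z hzC h1 h2), Real.one_lt_exp_iff] at hE
    rw [hh z hzC h1 h2]; exact hE
  · intro z hz hz2
    refine hneg _ isPreconnected_connectedComponentIn (connectedComponentIn_subset _ _) (-1)
      (mem_connectedComponentIn (mone_notin A B)) X.E_mone z hz ?_ hz2
    rintro rfl
    apply X.sep
    rw [← connectedComponentIn_eq hz]
    exact mem_connectedComponentIn (mone_notin A B)
  · intro z hz hz1
    refine hneg _ isPreconnected_connectedComponentIn (connectedComponentIn_subset _ _) 1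
      (mem_connectedComponentIn (one_notin A B)) X.E_one z hz hz1 ?_
    rintro rfl
    exact X.sep hz

end
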